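/- arXiv:2507.22597 — 3 statements merged into one kernel-verified Lean document; each statement's English description precedes it below -/
import Mathlib

section
/- Let 1 ≤ d ≤ w_1 q and let μ = x_1^{a_1} ⋯ x_s^{a_s} ∈ M̄ be a monomial of weighted degree d with exponent of x_0 equal to zero, a_s > 0 and w_s > w_1. Let α_0, α_1 be the unique integers with a_s w_s = α_0 + α_1 w_1, 1 ≤ α_0 ≤ w_1 and α_1 ≥ 1. Then FB( x_1^{a_1} ⋯ x_s^{a_s} ) ≥ FB( x_0^{α_0} x_1^{a_1 + α_1} x_2^{a_2} ⋯ x_{s−1}^{a_{s−1}} ). -/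
open MvPolynomial

noncomputable section

/-- `pSum q k = 1 + q + ⋯ + q^(k-1)`; so `p_m = pSum q (m+1)`. -/
def pSum (q k : ℕ) : ℕ := ∑ i ∈ Finset.range k, q ^ i

/-- Equivalence of nonzero vectors under weighted scaling by the algebraic closure. -/
def wRel (F : Type) [Field F] {m : ℕ} (w : Fin (m + 1) → ℕ)
    (x y : {v : Fin (m + 1) → AlgebraicClosure F // v ≠ 0}) : Prop :=
  ∃ lam : (AlgebraicClosure F)ˣ, ∀ i, y.1 i = (lam : AlgebraicClosure F) ^ w i * x.1 i

/-- The weighted projective space `ℙ(w)` as set of orbits. -/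
def PW (F : Type) [Field F] {m : ℕ} (w : Fin (m + 1) → ℕ) : Type :=
  Quot (wRel F w)

def PW.mk (F : Type) [Field F] {m : ℕ} (w : Fin (m + 1) → ℕ)
    (x : {v : Fin (m + 1) → AlgebraicClosure F // v ≠ 0}) : PW F w :=
  Quot.mk _ x

/-- The `𝔽_q`-rational points of `ℙ(w)`: orbits fixed by coordinatewise Frobenius. -/
def ratPts (F : Type) [Field F] [Fintype F] {m : ℕ} (w : Fin (m + 1) → ℕ) :
    Set (PW F w) :=
  {c | ∃ x : {v : Fin (m + 1) → AlgebraicClosure F // v ≠ 0},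
    PW.mk F w x = c ∧
    ∃ h : (fun i => x.1 i ^ Fintype.card F) ≠ (0 : Fin (m + 1) → AlgebraicClosure F),
      PW.mk F w ⟨fun i => x.1 i ^ Fintype.card F, h⟩ = c}

/-- `V_{ℙ(w)}(f)(𝔽_q)`: the rational points at which `f` vanishes. -/
def vanishSet (F : Type) [Field F] [Fintype F] {m : ℕ} (w : Fin (m + 1) → ℕ)
    (f : MvPolynomial (Fin (m + 1)) F) : Set (PW F w) :=
  {c | c ∈ ratPts F w ∧ ∀ x, PW.mk F w x = c →
    MvPolynomial.eval x.1 (MvPolynomial.map (algebraMap F (AlgebraicClosure F)) f) = 0}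

/-- `e_q(d; w)`: the maximal number of rational zeroes of a nonzero
weighted homogeneous polynomial of degree `d`. -/
def eMax (F : Type) [Field F] [Fintype F] {m : ℕ} (w : Fin (m + 1) → ℕ) (d : ℕ) : ℕ :=
  sSup {n | ∃ f : MvPolynomial (Fin (m + 1)) F,
    f ≠ 0 ∧ MvPolynomial.IsWeightedHomogeneous w f d ∧ n = (vanishSet F w f).ncard}

/-- weighted degree of a monomial (exponent vector). -/
def wdeg {m : ℕ} (w : Fin (m + 1) → ℕ) (a : Fin (m + 1) →₀ ℕ) : ℕ := ∑ i, w i * a i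

/-- degree-lexicographic order (weighted degree first, `x_0 < x_1 < ⋯ < x_m`). -/
def dlexLt {m : ℕ} (w : Fin (m + 1) → ℕ) (a b : Fin (m + 1) →₀ ℕ) : Prop :=
  wdeg w a < wdeg w b ∨
    (wdeg w a = wdeg w b ∧ ∃ i, a i < b i ∧ ∀ j, i < j → a j = b j)

/-- `a` is the initial monomial of `f` for the weighted deglex order. -/
def IsInitial (F : Type) [Field F] {m : ℕ} (w : Fin (m + 1) → ℕ)
    (f : MvPolynomial (Fin (m + 1)) F) (a : Fin (m + 1) →₀ ℕ) : Prop :=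
  a ∈ f.support ∧ ∀ b ∈ f.support, b ≠ a → dlexLt w b a

/-- The vanishing ideal `I(ℙ(w)(𝔽_q))`, generated by the homogeneous polynomials
vanishing at every rational point. -/
def vanishingIdeal (F : Type) [Field F] [Fintype F] {m : ℕ} (w : Fin (m + 1) → ℕ) :
    Ideal (MvPolynomial (Fin (m + 1)) F) :=
  Ideal.span {g | (∃ e, MvPolynomial.IsWeightedHomogeneous w g e) ∧
    ∀ c ∈ ratPts F w, ∀ x, PW.mk F w x = c →
      MvPolynomial.eval x.1 (MvPolynomial.map (algebraMap F (AlgebraicClosure F)) g) = 0}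

/-- `M̄`: monomials divisible by no initial monomial of a nonzero homogeneous
element of the vanishing ideal. -/
def Mbar (F : Type) [Field F] [Fintype F] {m : ℕ} (w : Fin (m + 1) → ℕ) :
    Set (Fin (m + 1) →₀ ℕ) :=
  {a | ¬ ∃ g : MvPolynomial (Fin (m + 1)) F, g ≠ 0 ∧ g ∈ vanishingIdeal F w ∧
    (∃ e, MvPolynomial.IsWeightedHomogeneous w g e) ∧ ∃ b, IsInitial F w g b ∧ b ≤ a}

/-- `M̄_d`. -/
def MbarD (F : Type) [Field F] [Fintype F] {m : ℕ} (w : Fin (m + 1) → ℕ) (d : ℕ) :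
    Set (Fin (m + 1) →₀ ℕ) :=
  {a ∈ Mbar F w | wdeg w a = d}

/-- `M̄_{d,i}`. -/
def MbarDI (F : Type) [Field F] [Fintype F] {m : ℕ} (w : Fin (m + 1) → ℕ) (d : ℕ)
    (i : Fin (m + 1)) : Set (Fin (m + 1) →₀ ℕ) :=
  {a ∈ MbarD F w d | (∀ t, t < i → a t = 0) ∧ 1 ≤ a i}

/-- The regularity set `reg(ℙ(w)(𝔽_q)) = {d ≥ 1 : |M̄_d| = p_m}`. -/
def regSet (F : Type) [Field F] [Fintype F] {m : ℕ} (w : Fin (m + 1) → ℕ) : Set ℕ :=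
  {d | 1 ≤ d ∧ (MbarD F w d).ncard = pSum (Fintype.card F) (m + 1)}

/-- Footprint bound at level `dtil`: number of monomials of `M̄_{dtil}` divisible by `a`. -/
def FB (F : Type) [Field F] [Fintype F] {m : ℕ} (w : Fin (m + 1) → ℕ) (dtil : ℕ)
    (a : Fin (m + 1) →₀ ℕ) : ℕ :=
  {b | b ∈ MbarD F w dtil ∧ a ≤ b}.ncard

/-- `FB_i`: number of monomials of `M̄_{dtil, i}` divisible by `a`. -/
def FBi (F : Type) [Field F] [Fintype F] {m : ℕ} (w : Fin (m + 1) → ℕ) (dtil : ℕ)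
    (i : Fin (m + 1)) (a : Fin (m + 1) →₀ ℕ) : ℕ :=
  {b | b ∈ MbarDI F w dtil i ∧ a ≤ b}.ncard

/-- Hilbert function of `𝔽_q[x]/I(ℙ(w)(𝔽_q))` at degree `d`. -/
def hilb (F : Type) [Field F] [Fintype F] {m : ℕ} (w : Fin (m + 1) → ℕ) (d : ℕ) : ℕ :=
  Module.finrank F
    (↥(weightedHomogeneousSubmodule F w d) ⧸
      (Submodule.comap (weightedHomogeneousSubmodule F w d).subtype
        (Submodule.restrictScalars F (vanishingIdeal F w))))

/-- Denumerant: the number of representations `d = w0*i0 + w1*i1`. -/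
def den (w0 w1 d : ℕ) : ℕ := {p : ℕ × ℕ | w0 * p.1 + w1 * p.2 = d}.ncard


theorem wRel_equivalence (F : Type) [Field F] {m : ℕ} (w : Fin (m + 1) → ℕ) :
    Equivalence (wRel F w) := by
  refine ⟨fun x => ⟨1, fun i => by simp⟩, ?_, ?_⟩
  · rintro x y ⟨l, h⟩
    refine ⟨l⁻¹, fun i => ?_⟩
    rw [h i, ← mul_assoc, ← mul_pow]
    simp
  · rintro x y z ⟨l, h⟩ ⟨k, h'⟩
    refine ⟨k * l, fun i => ?_⟩
    rw [h' i, h i]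
    push_cast
    ring

theorem PW_mk_eq {F : Type} [Field F] {m : ℕ} {w : Fin (m + 1) → ℕ}
    {x y : {v : Fin (m + 1) → AlgebraicClosure F // v ≠ 0}}
    (h : PW.mk F w x = PW.mk F w y) : wRel F w x y :=
  ((wRel_equivalence F w).quot_mk_eq_iff x y).1 h

theorem frob_of_ratPts {F : Type} [Field F] [Fintype F] {m : ℕ} {w : Fin (m + 1) → ℕ}
    {x : {v : Fin (m + 1) → AlgebraicClosure F // v ≠ 0}}
    (h : PW.mk F w x ∈ ratPts F w) :
    ∃ lam : (AlgebraicClosure F)ˣ, ∀ i,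
      x.1 i ^ Fintype.card F = (lam : AlgebraicClosure F) ^ w i * x.1 i := by
  obtain ⟨y, hy, hne, hyq⟩ := h
  obtain ⟨k, hk⟩ := PW_mk_eq hy
  obtain ⟨l, hl⟩ := PW_mk_eq (hy.trans hyq.symm)
  obtain ⟨n, hn⟩ := PW_mk_eq hyq
  simp only at hn
  -- x = n * y^q, x = k * y ; x^q = k^q * y^q = k^q * n⁻¹ * x
  refine ⟨k ^ Fintype.card F * n⁻¹, fun i => ?_⟩
  have h1 := hk i
  have h2 := hn i
  have h3 : ((n⁻¹ : (AlgebraicClosure F)ˣ) : AlgebraicClosure F) * n = 1 := by simp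
  calc x.1 i ^ Fintype.card F = ((k : AlgebraicClosure F) ^ w i * y.1 i) ^ Fintype.card F := by
        rw [h1]
    _ = ((k : AlgebraicClosure F) ^ Fintype.card F) ^ w i * y.1 i ^ Fintype.card F := by
        rw [mul_pow, ← pow_mul, ← pow_mul, mul_comm (w i)]
    _ = ((k : AlgebraicClosure F) ^ Fintype.card F) ^ w i *
        (((n⁻¹ : (AlgebraicClosure F)ˣ) : AlgebraicClosure F) * n) ^ w i *
          y.1 i ^ Fintype.card F := by rw [h3, one_pow, mul_one]
    _ = _ := by
        rw [h2, Units.val_mul, Units.val_pow_eq_pow_val]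
        ring

theorem wdeg_single_add {m : ℕ} (w : Fin (m + 1) → ℕ) (i j : Fin (m + 1)) (a b : ℕ) :
    wdeg w (Finsupp.single i a + Finsupp.single j b) = w i * a + w j * b := by
  classical
  simp [wdeg, Finsupp.single_apply, mul_add, Finset.sum_add_distrib]

theorem weight_eq_wdeg {m : ℕ} (w : Fin (m + 1) → ℕ) (b : Fin (m + 1) →₀ ℕ) :
    Finsupp.weight w b = wdeg w b := by
  rw [Finsupp.weight_apply, Finsupp.sum_fintype _ _ (by simp)]
  simp [wdeg, mul_comm]

/-- Monomials of `Mbar` divisible by `x_0` are reduced. -/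
theorem Mbar_reduced (F : Type) [Field F] [Fintype F] {m : ℕ} (w : Fin (m + 1) → ℕ)
    (hw0 : w 0 = 1) {b : Fin (m + 1) →₀ ℕ} (hb : b ∈ Mbar F w) (hb0 : 1 ≤ b 0)
    (j : Fin (m + 1)) (hj : j ≠ 0) : b j < Fintype.card F := by
  classical
  by_contra hlt
  push Not at hlt
  have hq : 1 < Fintype.card F := Fintype.one_lt_card
  apply hb
  set q := Fintype.card F with hqdef
  set u : Fin (m + 1) →₀ ℕ := Finsupp.single 0 1 + Finsupp.single j q with hu
  set v : Fin (m + 1) →₀ ℕ := Finsupp.single 0 (1 + w j * (q - 1)) + Finsupp.single j 1 with hv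
  have huj : u j = q := by simp [hu, hj]
  have hvj : v j = 1 := by simp [hv, hj]
  have huv : u ≠ v := by
    intro h
    rw [h, hvj] at huj
    omega
  have hdu : wdeg w u = 1 + w j * q := by rw [hu, wdeg_single_add, hw0]
  have hdv : wdeg w v = 1 + w j * q := by
    rw [hv, wdeg_single_add, hw0]
    obtain ⟨r, hr⟩ : ∃ r, q = r + 1 := ⟨q - 1, by omega⟩
    rw [hr, Nat.add_sub_cancel]; ring
  have hcu : coeff u (monomial u (1 : F) - monomial v 1) = 1 := by
    simp [coeff_monomial, huv.symm]
  have hhom : IsWeightedHomogeneous w (monomial u (1 : F) - monomial v 1) (1 + w j * q) := by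
    refine (weightedHomogeneousSubmodule F w _).sub_mem ?_ ?_
    · exact isWeightedHomogeneous_monomial w u 1 (by rw [weight_eq_wdeg, hdu])
    · exact isWeightedHomogeneous_monomial w v 1 (by rw [weight_eq_wdeg, hdv])
  refine ⟨monomial u 1 - monomial v 1, ?_, ?_, ⟨_, hhom⟩, u, ⟨?_, ?_⟩, ?_⟩
  · intro h
    rw [h] at hcu
    simp at hcu
  · apply Ideal.subset_span
    refine ⟨⟨_, hhom⟩, ?_⟩
    rintro c hc x rfl
    obtain ⟨l, hl⟩ := frob_of_ratPts hc
    have e : MvPolynomial.eval x.1 (MvPolynomial.map (algebraMap F (AlgebraicClosure F))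
        (monomial u (1 : F) - monomial v 1)) =
        x.1 0 * x.1 j ^ q - x.1 0 ^ (1 + w j * (q - 1)) * x.1 j := by
      rw [map_sub, map_sub, map_monomial, map_monomial, eval_monomial, eval_monomial, hu, hv,
        Finsupp.prod_add_index' (by simp) (by intros; rw [pow_add]),
        Finsupp.prod_add_index' (by simp) (by intros; rw [pow_add]),
        Finsupp.prod_single_index (by simp), Finsupp.prod_single_index (by simp),
        Finsupp.prod_single_index (by simp), Finsupp.prod_single_index (by simp)]
      simp only [map_one, one_mul, pow_one]
    rw [e]
    by_cases hx : x.1 0 = 0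
    · simp [hx]
    · have h0 := hl 0
      rw [hw0, pow_one] at h0
      have h1 : x.1 0 ^ (q - 1) = l := by
        apply mul_right_cancel₀ hx
        rw [← h0, ← pow_succ]
        congr 1
        omega
      rw [hl j, ← h1]
      ring
  · rw [mem_support_iff, hcu]; exact one_ne_zero
  · intro c hc hcu'
    have hcv : c = v := by
      by_contra hne
      rw [mem_support_iff] at hc
      apply hc
      simp [coeff_monomial, Ne.symm hcu', Ne.symm hne]
    subst hcv
    right
    refine ⟨by rw [hdu, hdv], j, by rw [huj, hvj]; exact hq, ?_⟩
    intro k hk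
    have hk0 : k ≠ 0 := by
      rintro rfl
      exact absurd hk (by simp)
    simp [hu, hv, Finsupp.single_apply, hk.ne, hk0.symm]
  · intro k
    by_cases hk : k = j
    · subst hk; rw [huj]; exact hlt
    · by_cases hk0 : k = 0
      · subst hk0; simpa [hu, Finsupp.single_apply, hj] using hb0
      · simp [hu, Finsupp.single_apply, Ne.symm hk, Ne.symm hk0]

/-- Elements of the vanishing ideal vanish at affine rational points. -/
theorem vanishingIdeal_eval (F : Type) [Field F] [Fintype F] {m : ℕ} (w : Fin (m + 1) → ℕ)
    {g : MvPolynomial (Fin (m + 1)) F} (hg : g ∈ vanishingIdeal F w)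
    (v : Fin (m + 1) → F) (hv : v 0 = 1) : eval v g = 0 := by
  have hle : vanishingIdeal F w ≤ RingHom.ker (eval v) := by
    refine Ideal.span_le.2 ?_
    rintro f ⟨-, hf⟩
    have hne : (fun i => algebraMap F (AlgebraicClosure F) (v i)) ≠ 0 := by
      intro h
      have := congrFun h 0
      simp [hv] at this
    have hfr : (fun i => (algebraMap F (AlgebraicClosure F) (v i)) ^ Fintype.card F) =
        fun i => algebraMap F (AlgebraicClosure F) (v i) := by
      funext i
      rw [← map_pow, FiniteField.pow_card]
    have := hf (PW.mk F w ⟨_, hne⟩) ⟨⟨_, hne⟩, rfl, by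
      refine ⟨?_, ?_⟩
      · simp only [hfr]; exact hne
      · congr 1
        exact Subtype.ext hfr⟩ ⟨_, hne⟩ rfl
    simp only [eval_map] at this
    rw [show (fun i => algebraMap F (AlgebraicClosure F) (v i)) =
      (algebraMap F (AlgebraicClosure F)) ∘ v from rfl, ← eval₂_comp] at this
    simpa using this
  exact hle hg

/-- reduction of exponents -/
def redExp (q n : ℕ) : ℕ := if n = 0 then 0 else (n - 1) % (q - 1) + 1

theorem redExp_le (q n : ℕ) : redExp q n ≤ n := by
  unfold redExp
  split_ifs with h
  · omega
  · have := Nat.mod_le (n - 1) (q - 1)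
    omega

theorem redExp_lt (q n : ℕ) (hq : 1 < q) : redExp q n ≤ q - 1 := by
  unfold redExp
  split_ifs with h
  · omega
  · have := Nat.mod_lt (n - 1) (show 0 < q - 1 by omega)
    omega

theorem redExp_eq (q n : ℕ) (hn : n < q) : redExp q n = n := by
  unfold redExp
  split_ifs with h
  · omega
  · rw [Nat.mod_eq_of_lt (by omega)]
    omega

theorem pow_redExp (F : Type) [Field F] [Fintype F] (x : F) (n : ℕ) :
    x ^ redExp (Fintype.card F) n = x ^ n := by
  unfold redExp
  split_ifs with h
  · rw [h]
  · by_cases hx : x = 0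
    · rw [hx, zero_pow h, zero_pow (by omega)]
    · have h1 := FiniteField.pow_card_sub_one_eq_one x hx
      have h2 := Nat.mod_add_div (n - 1) (Fintype.card F - 1)
      have h3 : n = (n - 1) % (Fintype.card F - 1) + 1 +
          (Fintype.card F - 1) * ((n - 1) / (Fintype.card F - 1)) := by omega
      conv_rhs => rw [h3, pow_add, pow_mul, h1, one_pow, mul_one]

/-- reduction of exponent vectors, killing the zeroth coordinate -/
def redVec (q : ℕ) {m : ℕ} (b : Fin (m + 1) →₀ ℕ) : Fin (m + 1) →₀ ℕ :=
  Finsupp.equivFunOnFinite.symm fun i => if i = 0 then 0 else redExp q (b i)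

theorem redVec_apply (q : ℕ) {m : ℕ} (b : Fin (m + 1) →₀ ℕ) (i : Fin (m + 1)) :
    redVec q b i = if i = 0 then 0 else redExp q (b i) := rfl

/-- Reduced monomials are in `Mbar`. -/
theorem Mbar_of_reduced (F : Type) [Field F] [Fintype F] {m : ℕ} (w : Fin (m + 1) → ℕ)
    (hw0 : w 0 = 1) {b : Fin (m + 1) →₀ ℕ}
    (hb : ∀ j : Fin (m + 1), j ≠ 0 → b j < Fintype.card F) : b ∈ Mbar F w := by
  classical
  rintro ⟨g, -, hgI, ⟨e, hhom⟩, c, ⟨hcs, hcmax⟩, hcb⟩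
  have hq : 1 < Fintype.card F := Fintype.one_lt_card
  set q := Fintype.card F with hqdef
  have hdeg : ∀ a ∈ g.support, wdeg w a = e := by
    intro a ha
    rw [← weight_eq_wdeg]
    exact hhom (mem_support_iff.1 ha)
  set h : MvPolynomial (Fin (m + 1)) F :=
    ∑ a ∈ g.support, monomial (redVec q a) (coeff a g) with hh
  have hres : h ∈ restrictDegree (Fin (m + 1)) F (q - 1) := by
    refine Submodule.sum_mem _ fun a _ => ?_
    rw [mem_restrictDegree]
    intro s hs i
    have : s = redVec q a := by
      have := support_monomial_subset hs
      simpa using this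
    rw [this, redVec_apply]
    split_ifs
    · omega
    · exact redExp_lt q _ hq
  have hev : ∀ v : Fin (m + 1) → F, eval v h = 0 := by
    intro v
    rw [← vanishingIdeal_eval F w hgI (Function.update v 0 1) (by simp), hh, map_sum, eval_eq']
    refine Finset.sum_congr rfl fun a _ => ?_
    rw [eval_monomial, Finsupp.prod_fintype _ _ (by simp)]
    congr 1
    refine Finset.prod_congr rfl fun i _ => ?_
    rw [redVec_apply]
    split_ifs with hi
    · subst hi; simp
    · rw [pow_redExp, Function.update_of_ne hi]
  have h0 : h = 0 := eq_zero_of_eval_eq_zero _ _ h hev hres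
  have hco : coeff (redVec q c) h = coeff c g := by
    rw [hh, coeff_sum, Finset.sum_eq_single c]
    · simp
    · intro a ha hac
      rw [coeff_monomial, if_neg]
      intro heq
      rcases hcmax a ha hac with hlt | ⟨hw, i, hi, hij⟩
      · rw [hdeg a ha, hdeg c hcs] at hlt
        exact lt_irrefl _ hlt
      · by_cases hi0 : i = 0
        · subst hi0
          simp only [wdeg, Fin.sum_univ_succ, hw0] at hw
          have : ∀ k : Fin m, a k.succ = c k.succ := fun k => hij _ (Fin.succ_pos k)
          simp only [this] at hw
          omega
        · have h1 := DFunLike.congr_fun heq i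
          rw [redVec_apply, redVec_apply, if_neg hi0, if_neg hi0,
            redExp_eq q (c i) (lt_of_le_of_lt (hcb i) (hb i hi0))] at h1
          have := redExp_le q (a i)
          omega
    · intro hc; exact absurd hcs hc
  rw [h0, coeff_zero] at hco
  exact (mem_support_iff.1 hcs) hco.symm

/-- Box of reduced exponents above `lo` (zeroth coordinate set to zero). -/
def expBox (q : ℕ) {m : ℕ} (lo : Fin (m + 1) → ℕ) : Finset (Fin (m + 1) → ℕ) :=
  Fintype.piFinset fun i => if i = 0 then {0} else Finset.Ico (lo i) q

theorem mem_expBox (q : ℕ) {m : ℕ} (lo f : Fin (m + 1) → ℕ) :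
    f ∈ expBox q lo ↔ f 0 = 0 ∧ ∀ i, i ≠ 0 → lo i ≤ f i ∧ f i < q := by
  rw [expBox, Fintype.mem_piFinset]
  constructor
  · intro h
    refine ⟨by simpa using h 0, fun i hi => by simpa [hi] using h i⟩
  · rintro ⟨h0, h⟩ i
    by_cases hi : i = 0
    · subst hi; simpa using h0
    · simpa [hi] using h i hi

theorem card_expBox (q : ℕ) {m : ℕ} (lo : Fin (m + 1) → ℕ) :
    (expBox q lo).card = ∏ i, if i = 0 then 1 else q - lo i := by
  rw [expBox, Fintype.card_piFinset]
  refine Finset.prod_congr rfl fun i _ => ?_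
  split_ifs <;> simp

theorem card_expBox_le (q : ℕ) {m : ℕ} (lo lo' : Fin (m + 1) → ℕ) (t s : Fin (m + 1))
    (ht : t ≠ 0) (hs : s ≠ 0) (hts : t ≠ s)
    (hrest : ∀ i, i ≠ 0 → i ≠ t → i ≠ s → lo i = lo' i)
    (hmain : (q - lo t) * (q - lo s) ≤ (q - lo' t) * (q - lo' s)) :
    (expBox q lo).card ≤ (expBox q lo').card := by
  classical
  rw [card_expBox, card_expBox]
  have key : ∀ f : Fin (m + 1) → ℕ, ∏ i, f i =
      f t * f s * ∏ i ∈ (Finset.univ.erase t).erase s, f i := by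
    intro f
    rw [← Finset.mul_prod_erase Finset.univ f (Finset.mem_univ t),
      ← Finset.mul_prod_erase (Finset.univ.erase t) f (a := s) (by simp [hts.symm]), mul_assoc]
  rw [key, key]
  simp only [ht, hs, if_false]
  refine Nat.mul_le_mul hmain (le_of_eq ?_)
  refine Finset.prod_congr rfl fun i hi => ?_
  simp only [Finset.mem_erase, Finset.mem_univ, and_true] at hi
  split_ifs with h0
  · rfl
  · rw [hrest i h0 hi.2 hi.1]

theorem wdeg_zero_add {m : ℕ} (w : Fin (m + 1) → ℕ) (hw0 : w 0 = 1) (b : Fin (m + 1) →₀ ℕ) :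
    wdeg w b = b 0 + ∑ k : Fin m, w k.succ * b k.succ := by
  simp [wdeg, Fin.sum_univ_succ, hw0]

theorem MbarD_finite (F : Type) [Field F] [Fintype F] {m : ℕ} (w : Fin (m + 1) → ℕ)
    (hpos : ∀ i, 1 ≤ w i) (d : ℕ) : (MbarD F w d).Finite := by
  classical
  refine Set.Finite.subset (Set.finite_Iic (Finsupp.equivFunOnFinite.symm fun _ => d)) ?_
  rintro b ⟨-, hb⟩ i
  have h1 : w i * b i ≤ wdeg w b :=
    Finset.single_le_sum (f := fun i => w i * b i) (fun _ _ => Nat.zero_le _) (Finset.mem_univ i)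
  have h2 : b i ≤ w i * b i := Nat.le_mul_of_pos_left _ (hpos i)
  show b i ≤ d
  omega

theorem FB_le_card (F : Type) [Field F] [Fintype F] {m : ℕ} (w : Fin (m + 1) → ℕ)
    (hw0 : w 0 = 1) (d : ℕ) (a : Fin (m + 1) →₀ ℕ) (ha : 1 ≤ a 0) :
    FB F w d a ≤ (expBox (Fintype.card F) a).card := by
  classical
  rw [← Set.ncard_coe_finset]
  refine Set.ncard_le_ncard_of_injOn (fun b => Function.update (b : Fin (m + 1) → ℕ) 0 0)
    ?_ ?_ (Finset.finite_toSet _)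
  · rintro b ⟨⟨hb, -⟩, hab⟩
    rw [Finset.mem_coe, mem_expBox]
    refine ⟨by simp, fun i hi => ?_⟩
    simp only [Function.update_of_ne hi]
    exact ⟨hab i, Mbar_reduced F w hw0 hb (ha.trans (hab 0)) i hi⟩
  · rintro b ⟨⟨-, hb⟩, -⟩ c ⟨⟨-, hc⟩, -⟩ hbc
    have h1 : ∀ k : Fin m, b k.succ = c k.succ := by
      intro k
      have := congrFun hbc k.succ
      simpa [Function.update_of_ne (Fin.succ_ne_zero k)] using this
    rw [wdeg_zero_add w hw0] at hb hc
    simp only [h1] at hb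
    ext i
    refine Fin.cases ?_ h1 i
    omega

theorem card_le_FB (F : Type) [Field F] [Fintype F] {m : ℕ} (w : Fin (m + 1) → ℕ)
    (hpos : ∀ i, 1 ≤ w i) (hw0 : w 0 = 1) (d : ℕ)
    (hd : ∑ k : Fin m, w k.succ * Fintype.card F ≤ d)
    (a : Fin (m + 1) →₀ ℕ) (ha : a 0 = 0) :
    (expBox (Fintype.card F) a).card ≤ FB F w d a := by
  classical
  rw [← Set.ncard_coe_finset]
  refine Set.ncard_le_ncard_of_injOn (fun f => Finsupp.equivFunOnFinite.symm
    (Function.update f 0 (d - ∑ k : Fin m, w k.succ * f k.succ))) ?_ ?_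
    ((MbarD_finite F w hpos d).subset fun b hb => hb.1)
  · intro f hf
    rw [Finset.mem_coe, mem_expBox] at hf
    refine ⟨⟨?_, ?_⟩, ?_⟩
    · refine Mbar_of_reduced F w hw0 fun j hj => ?_
      simpa [Function.update_of_ne hj] using (hf.2 j hj).2
    · rw [wdeg_zero_add w hw0]
      have : ∑ k : Fin m, w k.succ * f k.succ ≤ ∑ k : Fin m, w k.succ * Fintype.card F :=
        Finset.sum_le_sum fun k _ =>
          Nat.mul_le_mul le_rfl (hf.2 k.succ (Fin.succ_ne_zero k)).2.le
      simp [Function.update_of_ne (Fin.succ_ne_zero _)]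
      omega
    · intro i
      by_cases hi : i = 0
      · subst hi; rw [ha]; exact Nat.zero_le _
      · simpa [Function.update_of_ne hi] using (hf.2 i hi).1
  · intro f hf g hg hfg
    rw [Finset.mem_coe, mem_expBox] at hf hg
    have h := Finsupp.equivFunOnFinite.symm.injective hfg
    funext i
    by_cases hi : i = 0
    · subst hi; rw [hf.1, hg.1]
    · have := congrFun h i
      simpa [Function.update_of_ne hi] using this

/-- Lemma 3.3 of the paper: replacing the top variable `x_s`
(with `w_s > w_1`) by `x_0^{α_0} x_1^{α_1}` does not increase the footprint bound. -/
theorem stmt9 (F : Type) [Field F] [Fintype F] (m ℓ : ℕ) (w : Fin (m + 1) → ℕ)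
    (hℓ1 : 1 ≤ ℓ) (hℓm : ℓ + 1 ≤ m)
    (hpos : ∀ i, 1 ≤ w i)
    (hw0 : w ⟨0, by omega⟩ = 1)
    (hweq : ∀ i : Fin (m + 1), 1 ≤ (i : ℕ) → (i : ℕ) ≤ ℓ → w i = w ⟨1, by omega⟩)
    (hlt : w ⟨ℓ, by omega⟩ < w ⟨ℓ + 1, by omega⟩)
    (hmono : ∀ i j : Fin (m + 1), ℓ + 1 ≤ (i : ℕ) → i ≤ j → w i ≤ w j)
    (d : ℕ) (hd1 : 1 ≤ d) (hdq : d ≤ w ⟨1, by omega⟩ * Fintype.card F)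
    (a : Fin (m + 1) →₀ ℕ) (ha : a ∈ Mbar F w) (hdeg : wdeg w a = d)
    (ha0 : a ⟨0, by omega⟩ = 0)
    (s : Fin (m + 1)) (has : 0 < a s) (hws : w ⟨1, by omega⟩ < w s)
    (htail : ∀ j : Fin (m + 1), s < j → a j = 0)
    (α0 α1 : ℕ) (hα : a s * w s = α0 + α1 * w ⟨1, by omega⟩)
    (hα0 : 1 ≤ α0) (hα0' : α0 ≤ w ⟨1, by omega⟩) (hα1 : 1 ≤ α1) :
    ∃ N : ℕ, ∀ dtil ∈ regSet F w, N ≤ dtil →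
      FB F w dtil
          (Finsupp.update a s 0 + Finsupp.single ⟨0, by omega⟩ α0 +
            Finsupp.single ⟨1, by omega⟩ α1) ≤
        FB F w dtil a := by
  classical
  set o : Fin (m + 1) := ⟨1, by omega⟩ with ho
  have hz : (⟨0, by omega⟩ : Fin (m + 1)) = 0 := rfl
  simp only [hz] at hw0 ha0 ⊢
  set q := Fintype.card F with hq
  have hs0 : s ≠ 0 := by
    rintro rfl
    have := hpos o
    omega
  have hso : o ≠ s := by
    rintro h
    rw [← h] at hws
    exact lt_irrefl _ hws
  have ho0 : o ≠ 0 := by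
    intro h
    have := congrArg Fin.val h
    simp [ho] at this
  have hle : a s * w s ≤ d := by
    rw [← hdeg, mul_comm]
    exact Finset.single_le_sum (f := fun i => w i * a i) (fun _ _ => Nat.zero_le _)
      (Finset.mem_univ s)
  have hasq : a s < q := by
    by_contra hge
    push Not at hge
    have h1 : q * w o ≤ a s * w o := Nat.mul_le_mul hge le_rfl
    have h2 : a s * w o < a s * w s := Nat.mul_lt_mul_of_pos_left hws has
    have h3 : w o * q = q * w o := mul_comm _ _
    omega
  have hα1s : a s ≤ α1 := by
    by_contra hlt
    push Not at hlt
    have h1 : (α1 + 1) * w o ≤ a s * w o := Nat.mul_le_mul hlt le_rfl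
    have h2 : a s * w o < a s * w s := Nat.mul_lt_mul_of_pos_left hws has
    have h3 : (α1 + 1) * w o = α1 * w o + w o := by ring
    omega
  refine ⟨∑ k : Fin m, w k.succ * q, fun dtil _ hN => ?_⟩
  refine le_trans (FB_le_card F w hw0 dtil _ ?_) (le_trans ?_
    (card_le_FB F w hpos hw0 dtil hN a ha0))
  · simp [hα0]
    omega
  · refine card_expBox_le q _ _ o s ho0 hs0 hso ?_ ?_
    · intro i hi hio his
      simp [Finsupp.single_apply, hi.symm, hio.symm, Function.update_of_ne his]
    · have e1 : (Finsupp.update a s 0 + Finsupp.single 0 α0 + Finsupp.single o α1 : Fin (m + 1) →₀ ℕ) o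
          = a o + α1 := by
        simp [Finsupp.single_apply, ho0.symm, Function.update_of_ne hso]
      have e2 : (Finsupp.update a s 0 + Finsupp.single 0 α0 + Finsupp.single o α1 : Fin (m + 1) →₀ ℕ) s = 0 := by
        simp [Finsupp.single_apply, hs0.symm, hso]
      rw [e1, e2]
      rcases Nat.lt_or_ge q (a o + α1) with h | h
      · rw [Nat.sub_eq_zero_of_le h.le]; simp
      · obtain ⟨r, hr⟩ := Nat.exists_eq_add_of_le h
        obtain ⟨t, ht⟩ := Nat.exists_eq_add_of_le hα1s
        have f1 : q - (a o + α1) = r := by omega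
        have f2 : q - a o = a s + t + r := by omega
        have f3 : q - a s = a o + t + r := by omega
        rw [f1, f2, f3, Nat.sub_zero, hr, ht]
        nlinarith [Nat.zero_le (a s * a o), Nat.zero_le (a s * t), Nat.zero_le (t * a o),
          Nat.zero_le (t * t), Nat.zero_le (t * r)]

end
end

section
/- Let q be a prime power, (w_0, w_1) positive integers, and d ∈ ⟨w_0, w_1⟩_ℕ. Write the Euclidean division of d by lcm(w_0, w_1) as d = λ·lcm(w_0, w_1) + ρ with 0 ≤ ρ < lcm(w_0, w_1). Then e_q(d; w_0, w_1) = min{ q + 1, X }, where X = λ if both w_0 and w_1 divide d; X = λ + 1 if exactly one of w_0, w_1 divides d; and X = λ + 1 + den(ρ; w_0, w_1) if neither w_0 nor w_1 divides d. -/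
open MvPolynomial

noncomputable section

theorem hx_bezout {K : Type} [Field K] [IsAlgClosed K] (g a b : ℕ) (hg : 0 < g)
    (hab : Nat.Coprime a b) (r s : K) (hr : r ≠ 0) (hs : s ≠ 0) (h : r ^ b = s ^ a) :
    ∃ μ : Kˣ, (μ : K) ^ (g * a) = r ∧ (μ : K) ^ (g * b) = s := by
  have hbz : (1 : ℤ) = a * Nat.gcdA a b + b * Nat.gcdB a b := by
    have := Nat.gcd_eq_gcd_ab a b
    rw [hab] at this
    exact_mod_cast this
  set u := Nat.gcdA a b
  set v := Nat.gcdB a b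
  have hν0 : r ^ u * s ^ v ≠ 0 := mul_ne_zero (zpow_ne_zero _ hr) (zpow_ne_zero _ hs)
  obtain ⟨μ, hμ⟩ := IsAlgClosed.exists_pow_nat_eq (r ^ u * s ^ v) hg
  have hμ0 : μ ≠ 0 := by
    rintro rfl
    rw [zero_pow hg.ne'] at hμ
    exact hν0 hμ.symm
  have hz : r ^ (b : ℤ) = s ^ (a : ℤ) := by simpa using h
  refine ⟨Units.mk0 μ hμ0, ?_, ?_⟩
  · rw [Units.val_mk0, pow_mul, hμ]
    calc (r ^ u * s ^ v) ^ a = r ^ ((a : ℤ) * u) * (s ^ (a : ℤ)) ^ v := by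
          rw [mul_pow, ← zpow_natCast, ← zpow_natCast, ← zpow_mul, ← zpow_mul, ← zpow_mul,
            mul_comm u, mul_comm v]
      _ = r ^ ((a : ℤ) * u + b * v) := by rw [← hz, ← zpow_mul, zpow_add₀ hr]
      _ = r := by rw [← hbz, zpow_one]
  · rw [Units.val_mk0, pow_mul, hμ]
    calc (r ^ u * s ^ v) ^ b = (r ^ (b : ℤ)) ^ u * s ^ ((b : ℤ) * v) := by
          rw [mul_pow, ← zpow_natCast, ← zpow_natCast, ← zpow_mul, ← zpow_mul, ← zpow_mul,
            mul_comm u, mul_comm v]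
      _ = s ^ ((a : ℤ) * u + b * v) := by rw [hz, ← zpow_mul, zpow_add₀ hs]
      _ = s := by rw [← hbz, zpow_one]

open Classical in
/-- affine coordinate on nonzero vectors -/
def phi0 (F : Type) [Field F] (a b : ℕ)
    (x : {v : Fin (1 + 1) → AlgebraicClosure F // v ≠ 0}) : Option (AlgebraicClosure F) :=
  if x.1 1 = 0 then none else some (x.1 0 ^ b / x.1 1 ^ a)

theorem phi0_inv (F : Type) [Field F] (g a b : ℕ)
    (x y : {v : Fin (1 + 1) → AlgebraicClosure F // v ≠ 0})
    (h : wRel F ![g * a, g * b] x y) : phi0 F a b x = phi0 F a b y := by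
  obtain ⟨l, hl⟩ := h
  have e0 := hl 0
  have e1 := hl 1
  simp only [Matrix.cons_val_zero, Matrix.cons_val_one] at e0 e1
  unfold phi0
  rw [e0, e1]
  have hl0 : (l : AlgebraicClosure F) ≠ 0 := l.ne_zero
  by_cases h : x.1 1 = 0
  · simp [h]
  · simp only [h, mul_eq_zero, pow_eq_zero_iff', hl0, false_and, or_self, if_false]
    congr 1
    field_simp
    ring

/-- affine coordinate on the weighted projective line -/
def phi (F : Type) [Field F] (g a b : ℕ) : PW F ![g * a, g * b] → Option (AlgebraicClosure F) :=
  Quot.lift (phi0 F a b) (phi0_inv F g a b)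

theorem phi_mk (F : Type) [Field F] (g a b : ℕ)
    (x : {v : Fin (1 + 1) → AlgebraicClosure F // v ≠ 0}) :
    phi F g a b (PW.mk F _ x) = phi0 F a b x := rfl

theorem ne0_of (F : Type) [Field F]
    (x : {v : Fin (1 + 1) → AlgebraicClosure F // v ≠ 0}) (h : x.1 1 = 0) : x.1 0 ≠ 0 := by
  intro h0
  apply x.2
  funext i
  fin_cases i
  · exact h0
  · exact h

theorem phi_inj (F : Type) [Field F] (g a b : ℕ) (hg : 0 < g) (ha : 0 < a) (hb : 0 < b)
    (hab : Nat.Coprime a b) : Function.Injective (phi F g a b) := by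
  rintro ⟨x⟩ ⟨y⟩ h
  change phi0 F a b x = phi0 F a b y at h
  apply Quot.sound
  suffices hh : ∃ μ : (AlgebraicClosure F)ˣ, y.1 0 = (μ : AlgebraicClosure F) ^ (g * a) * x.1 0 ∧
      y.1 1 = (μ : AlgebraicClosure F) ^ (g * b) * x.1 1 by
    obtain ⟨μ, h0, h1⟩ := hh
    refine ⟨μ, fun i => ?_⟩
    fin_cases i
    · exact h0
    · exact h1
  have root : ∀ (n : ℕ) (r : AlgebraicClosure F), 0 < n → r ≠ 0 →
      ∃ μ : (AlgebraicClosure F)ˣ, (μ : AlgebraicClosure F) ^ n = r := by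
    intro n r hn hr
    obtain ⟨μ, hμ⟩ := IsAlgClosed.exists_pow_nat_eq r hn
    refine ⟨Units.mk0 μ ?_, hμ⟩
    rintro rfl
    rw [zero_pow hn.ne'] at hμ
    exact hr hμ.symm
  unfold phi0 at h
  by_cases hx : x.1 1 = 0
  · by_cases hy : y.1 1 = 0
    · have hx0 := ne0_of F x hx
      have hy0 := ne0_of F y hy
      obtain ⟨μ, hμ⟩ := root (g * a) (y.1 0 / x.1 0) (by positivity) (div_ne_zero hy0 hx0)
      refine ⟨μ, ?_, ?_⟩
      · rw [hμ]; field_simp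
      · rw [hx, hy, mul_zero]
    · simp [hx, hy] at h
  · by_cases hy : y.1 1 = 0
    · simp [hx, hy] at h
    · simp only [hx, hy, if_false, Option.some.injEq] at h
      by_cases hx0 : x.1 0 = 0
      · have hy0 : y.1 0 = 0 := by
          rw [hx0, zero_pow hb.ne', zero_div, eq_comm, div_eq_zero_iff] at h
          rcases h with h | h
          · exact pow_eq_zero_iff hb.ne' |>.1 h
          · exact absurd (pow_eq_zero_iff ha.ne' |>.1 h) hy
        obtain ⟨μ, hμ⟩ := root (g * b) (y.1 1 / x.1 1) (by positivity) (div_ne_zero hy hx)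
        refine ⟨μ, ?_, ?_⟩
        · rw [hx0, hy0, mul_zero]
        · rw [hμ]; field_simp
      · have hy0 : y.1 0 ≠ 0 := by
          intro hy0
          rw [hy0, zero_pow hb.ne', zero_div, div_eq_zero_iff] at h
          rcases h with h | h
          · exact hx0 (pow_eq_zero_iff hb.ne' |>.1 h)
          · exact hx (pow_eq_zero_iff ha.ne' |>.1 h)
        obtain ⟨μ, e0, e1⟩ := hx_bezout g a b hg hab (y.1 0 / x.1 0) (y.1 1 / x.1 1)
          (div_ne_zero hy0 hx0) (div_ne_zero hy hx) (by
            rw [div_pow, div_pow]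
            field_simp
            field_simp at h
            rw [mul_comm, ← h, mul_comm])
        refine ⟨μ, ?_, ?_⟩
        · rw [e0]; field_simp
        · rw [e1]; field_simp

theorem phi_surj (F : Type) [Field F] (g a b : ℕ) (hb : 0 < b) :
    Function.Surjective (phi F g a b) := by
  intro o
  cases o with
  | none =>
    refine ⟨PW.mk F _ ⟨![1, 0], fun h => by simpa using congrFun h 0⟩, ?_⟩
    rw [phi_mk]
    simp [phi0]
  | some t =>
    obtain ⟨s, hs⟩ := IsAlgClosed.exists_pow_nat_eq t hb
    refine ⟨PW.mk F _ ⟨![s, 1], fun h => by simpa using congrFun h 1⟩, ?_⟩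
    rw [phi_mk]
    simp [phi0, hs]

theorem frob_mem (F : Type) [Field F] [Fintype F] (t : AlgebraicClosure F)
    (h : t ^ Fintype.card F = t) : ∃ s : F, algebraMap F _ s = t := by
  have hne : (Polynomial.X ^ Fintype.card F - Polynomial.X : Polynomial F) ≠ 0 :=
    FiniteField.X_pow_card_sub_X_ne_zero F Fintype.one_lt_card
  have hs : (Polynomial.X ^ Fintype.card F - Polynomial.X : Polynomial F).Splits := by
    rw [Polynomial.splits_iff_card_roots, FiniteField.roots_X_pow_card_sub_X,
      FiniteField.X_pow_card_sub_X_natDegree_eq F Fintype.one_lt_card]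
    rfl
  exact hs.mem_range_of_isRoot hne (by simp [h])

theorem mem_ratPts (F : Type) [Field F] [Fintype F] (g a b : ℕ) (hg : 0 < g) (ha : 0 < a)
    (hb : 0 < b) (hab : Nat.Coprime a b) (c : PW F ![g * a, g * b]) :
    c ∈ ratPts F ![g * a, g * b] ↔
      ∃ o : Option F, o.map (algebraMap F (AlgebraicClosure F)) = phi F g a b c := by
  have hq : Fintype.card F ≠ 0 := Fintype.card_ne_zero
  constructor
  · rintro ⟨x, rfl, hne, h⟩
    have h2 := congrArg (phi F g a b) h
    rw [phi_mk, phi_mk] at h2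
    rw [phi_mk]
    unfold phi0 at h2 ⊢
    by_cases hx : x.1 1 = 0
    · exact ⟨none, by simp [hx]⟩
    · simp only [hx, pow_eq_zero_iff hq, if_false, Option.some.injEq] at h2 ⊢
      rw [← pow_mul, ← pow_mul, mul_comm, mul_comm _ a, pow_mul, pow_mul, ← div_pow] at h2
      obtain ⟨s, hs⟩ := frob_mem F _ h2
      exact ⟨some s, by simp [hs]⟩
  · rintro ⟨o, ho⟩
    induction c using Quot.ind with
    | mk x =>
    have hne : (fun i => x.1 i ^ Fintype.card F) ≠ (0 : Fin (1 + 1) → AlgebraicClosure F) := by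
      intro h
      apply x.2
      funext i
      have := congrFun h i
      exact (pow_eq_zero_iff hq).1 this
    refine ⟨x, rfl, hne, ?_⟩
    apply phi_inj F g a b hg ha hb hab
    change _ = phi0 F a b x
    change _ = phi0 F a b x at ho
    rw [phi_mk]
    unfold phi0 at ho ⊢
    by_cases hx : x.1 1 = 0
    · simp [hx, hq]
    · simp only [hx, pow_eq_zero_iff hq, if_false, Option.some.injEq] at ho ⊢
      rw [← pow_mul, ← pow_mul, mul_comm, mul_comm _ a, pow_mul, pow_mul, ← div_pow]
      cases o with
      | none => simp at ho
      | some s =>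
        simp only [Option.map_some, Option.some.injEq] at ho
        rw [← ho, ← map_pow, FiniteField.pow_card]

/-- exponent vector -/
def ex (i j : ℕ) : Fin (1 + 1) →₀ ℕ := Finsupp.equivFunOnFinite.symm ![i, j]

theorem ex_zero (i j : ℕ) : ex i j 0 = i := rfl
theorem ex_one (i j : ℕ) : ex i j 1 = j := rfl
theorem ex_eta (e : Fin (1 + 1) →₀ ℕ) : ex (e 0) (e 1) = e := by
  ext i
  fin_cases i <;> rfl

theorem weight_ex (w0 w1 : ℕ) (e : Fin (1 + 1) →₀ ℕ) :
    Finsupp.weight ![w0, w1] e = w0 * e 0 + w1 * e 1 := by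
  rw [Finsupp.weight_apply, Finsupp.sum_fintype _ _ (by simp)]
  simp [Fin.sum_univ_two, mul_comm]

/-- the weighted homogeneous polynomial attached to a univariate polynomial -/
def polyOf (F : Type) [Field F] (a b i0 j0 k : ℕ) (H : Polynomial F) :
    MvPolynomial (Fin (1 + 1)) F :=
  ∑ m ∈ Finset.range (k + 1), MvPolynomial.monomial (ex (i0 + b * m) (j0 + a * (k - m))) (H.coeff m)

theorem ex_inj (a b i0 j0 k : ℕ) (hb : 0 < b) (m n : ℕ)
    (h : ex (i0 + b * m) (j0 + a * (k - m)) = ex (i0 + b * n) (j0 + a * (k - n))) : m = n := by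
  have h0 := DFunLike.congr_fun h 0
  rw [ex_zero, ex_zero] at h0
  exact Nat.eq_of_mul_eq_mul_left hb (by omega)

theorem coeff_polyOf (F : Type) [Field F] (a b i0 j0 k : ℕ) (hb : 0 < b) (H : Polynomial F)
    (m : ℕ) (hm : m ≤ k) :
    (polyOf F a b i0 j0 k H).coeff (ex (i0 + b * m) (j0 + a * (k - m))) = H.coeff m := by
  classical
  unfold polyOf
  rw [MvPolynomial.coeff_sum, Finset.sum_eq_single m]
  · rw [MvPolynomial.coeff_monomial, if_pos rfl]
  · intro n _ hn
    rw [MvPolynomial.coeff_monomial, if_neg]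
    intro h
    exact hn (ex_inj a b i0 j0 k hb _ _ h)
  · intro h
    exact absurd (Finset.mem_range.2 (by omega)) h

theorem polyOf_hom (F : Type) [Field F] (g a b i0 j0 k : ℕ) (H : Polynomial F) :
    IsWeightedHomogeneous ![g * a, g * b] (polyOf F a b i0 j0 k H)
      (g * a * i0 + g * b * j0 + k * (g * a * b)) := by
  unfold polyOf
  refine IsWeightedHomogeneous.sum _ _ _ fun m hm => ?_
  apply isWeightedHomogeneous_monomial
  rw [weight_ex, ex_zero, ex_one]
  obtain ⟨r, rfl⟩ := Nat.exists_eq_add_of_le (Nat.lt_succ_iff.1 (Finset.mem_range.1 hm))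
  rw [Nat.add_sub_cancel_left]
  ring

theorem exists_polyOf (F : Type) [Field F] (g a b i0 j0 k d : ℕ) (hb : 0 < b)
    (hchar : ∀ i j, g * a * i + g * b * j = d → ∃ m ≤ k, i = i0 + b * m ∧ j = j0 + a * (k - m))
    (f : MvPolynomial (Fin (1 + 1)) F) (hf : IsWeightedHomogeneous ![g * a, g * b] f d) :
    ∃ H : Polynomial F, H.natDegree ≤ k ∧ f = polyOf F a b i0 j0 k H := by
  classical
  refine ⟨∑ m ∈ Finset.range (k + 1), Polynomial.monomial m
    (f.coeff (ex (i0 + b * m) (j0 + a * (k - m)))), ?_, ?_⟩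
  · apply Polynomial.natDegree_sum_le_of_forall_le
    intro m hm
    exact (Polynomial.natDegree_monomial_le _).trans (Nat.lt_succ_iff.1 (Finset.mem_range.1 hm))
  · set H := ∑ m ∈ Finset.range (k + 1), Polynomial.monomial m
      (f.coeff (ex (i0 + b * m) (j0 + a * (k - m)))) with hH
    have hco : ∀ m ≤ k, H.coeff m = f.coeff (ex (i0 + b * m) (j0 + a * (k - m))) := by
      intro m hm
      rw [hH, Polynomial.finsetSum_coeff, Finset.sum_eq_single m]
      · simp
      · intro n _ hn
        rw [Polynomial.coeff_monomial, if_neg hn]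
      · intro h
        exact absurd (Finset.mem_range.2 (by omega)) h
    ext e
    by_cases he : ∃ m ≤ k, e = ex (i0 + b * m) (j0 + a * (k - m))
    · obtain ⟨m, hm, rfl⟩ := he
      rw [coeff_polyOf F a b i0 j0 k hb H m hm, hco m hm]
    · have h1 : f.coeff e = 0 := by
        by_contra hne
        have := hf hne
        rw [weight_ex] at this
        obtain ⟨m, hm, h0, h1⟩ := hchar _ _ this
        exact he ⟨m, hm, by rw [← h0, ← h1, ex_eta]⟩
      rw [h1]
      unfold polyOf
      rw [MvPolynomial.coeff_sum, Finset.sum_eq_zero]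
      intro m hm
      rw [MvPolynomial.coeff_monomial, if_neg]
      intro h
      exact he ⟨m, Nat.lt_succ_iff.1 (Finset.mem_range.1 hm), h.symm⟩

theorem eval_polyOf (F : Type) [Field F] (a b i0 j0 k : ℕ) (H : Polynomial F)
    (x : Fin (1 + 1) → AlgebraicClosure F) :
    MvPolynomial.eval x (MvPolynomial.map (algebraMap F (AlgebraicClosure F))
      (polyOf F a b i0 j0 k H)) =
    ∑ m ∈ Finset.range (k + 1), algebraMap F (AlgebraicClosure F) (H.coeff m) *
      (x 0 ^ (i0 + b * m) * x 1 ^ (j0 + a * (k - m))) := by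
  unfold polyOf
  rw [map_sum, map_sum]
  refine Finset.sum_congr rfl fun m _ => ?_
  rw [MvPolynomial.map_monomial, MvPolynomial.eval_monomial, Finsupp.prod_fintype _ _ (by simp),
    Fin.prod_univ_two, ex_zero, ex_one]

/-- vanishing condition in the affine coordinate -/
def Zc (F K : Type) [Field F] [Field K] [Algebra F K] (i0 j0 k : ℕ) (H : Polynomial F) :
    Option K → Prop
  | none => j0 ≠ 0 ∨ H.coeff k = 0
  | some t => (i0 ≠ 0 ∧ t = 0) ∨ Polynomial.aeval t H = 0

theorem eval_iff (F : Type) [Field F] (a b i0 j0 k : ℕ) (ha : 0 < a) (hb : 0 < b)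
    (H : Polynomial F) (hH : H.natDegree ≤ k)
    (x : {v : Fin (1 + 1) → AlgebraicClosure F // v ≠ 0}) :
    MvPolynomial.eval x.1 (MvPolynomial.map (algebraMap F (AlgebraicClosure F))
      (polyOf F a b i0 j0 k H)) = 0 ↔ Zc F (AlgebraicClosure F) i0 j0 k H (phi0 F a b x) := by
  rw [eval_polyOf]
  unfold phi0
  by_cases hx : x.1 1 = 0
  · have hx0 := ne0_of F x hx
    rw [if_pos hx, Finset.sum_eq_single k]
    · simp only [Zc, hx, Nat.sub_self, mul_zero, add_zero]
      by_cases hj : j0 = 0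
      · simp [hj, hx0]
      · simp [hj]
    · intro m hm hmk
      have : j0 + a * (k - m) ≠ 0 := by
        have : 0 < a * (k - m) := Nat.mul_pos ha (by have := Finset.mem_range.1 hm; omega)
        omega
      rw [hx, zero_pow this, mul_zero, mul_zero]
    · intro h
      exact absurd (Finset.mem_range.2 (by omega)) h
  · rw [if_neg hx]
    have key : ∑ m ∈ Finset.range (k + 1), algebraMap F (AlgebraicClosure F) (H.coeff m) *
      (x.1 0 ^ (i0 + b * m) * x.1 1 ^ (j0 + a * (k - m))) =
      x.1 0 ^ i0 * x.1 1 ^ (j0 + a * k) * Polynomial.aeval (x.1 0 ^ b / x.1 1 ^ a) H := by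
      rw [Polynomial.aeval_eq_sum_range' (Nat.lt_succ_of_le hH), Finset.mul_sum]
      refine Finset.sum_congr rfl fun m hm => ?_
      obtain ⟨r, rfl⟩ := Nat.exists_eq_add_of_le (Nat.lt_succ_iff.1 (Finset.mem_range.1 hm))
      rw [Nat.add_sub_cancel_left, Algebra.smul_def, div_pow]
      field_simp
      ring
    rw [key]
    simp only [Zc, mul_eq_zero, pow_eq_zero_iff', hx, div_eq_zero_iff, false_and, or_false, hb.ne',
      ne_eq, not_false_eq_true, and_true]
    tauto

theorem ncard_vanish (F : Type) [Field F] [Fintype F] (g a b i0 j0 k : ℕ) (hg : 0 < g)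
    (ha : 0 < a) (hb : 0 < b) (hab : Nat.Coprime a b)
    (H : Polynomial F) (hH : H.natDegree ≤ k) :
    (vanishSet F ![g * a, g * b] (polyOf F a b i0 j0 k H)).ncard =
      {o : Option F | Zc F F i0 j0 k H o}.ncard := by
  have hinj := phi_inj F g a b hg ha hb hab
  have hinj2 : Function.Injective (Option.map (algebraMap F (AlgebraicClosure F))) :=
    Option.map_injective (algebraMap F (AlgebraicClosure F)).injective
  have hZ : ∀ o : Option F, Zc F (AlgebraicClosure F) i0 j0 k H
      (o.map (algebraMap F (AlgebraicClosure F))) ↔ Zc F F i0 j0 k H o := by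
    intro o
    cases o with
    | none => exact Iff.rfl
    | some t =>
      simp only [Zc, Option.map_some, Polynomial.aeval_algebraMap_apply]
      simp
  have hV : ∀ c : PW F ![g * a, g * b], c ∈ vanishSet F ![g * a, g * b] (polyOf F a b i0 j0 k H) ↔
      c ∈ ratPts F ![g * a, g * b] ∧ Zc F (AlgebraicClosure F) i0 j0 k H (phi F g a b c) := by
    intro c
    refine and_congr_right fun _ => ?_
    constructor
    · intro h
      induction c using Quot.ind with
      | mk x => exact (eval_iff F a b i0 j0 k ha hb H hH x).1 (h x rfl)
    · rintro h x rfl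
      exact (eval_iff F a b i0 j0 k ha hb H hH x).2 h
  rw [← Set.ncard_image_of_injective _ hinj, ← Set.ncard_image_of_injective _ hinj2]
  congr 1
  ext o
  constructor
  · rintro ⟨c, hc, rfl⟩
    obtain ⟨hr, hz⟩ := (hV c).1 hc
    obtain ⟨o, ho⟩ := (mem_ratPts F g a b hg ha hb hab c).1 hr
    refine ⟨o, ?_, ho⟩
    rw [← ho] at hz
    exact (hZ o).1 hz
  · rintro ⟨o, ho, rfl⟩
    obtain ⟨c, hc⟩ := phi_surj F g a b hb (o.map (algebraMap F (AlgebraicClosure F)))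
    refine ⟨c, (hV c).2 ⟨(mem_ratPts F g a b hg ha hb hab c).2 ⟨o, hc.symm⟩, ?_⟩, hc⟩
    rw [hc]
    exact (hZ o).2 ho

/-- indicator of being nonzero -/
def dl (n : ℕ) : ℕ := if n = 0 then 0 else 1

theorem Z_upper (F : Type) [Field F] [Fintype F] (i0 j0 k : ℕ)
    (H : Polynomial F) (hH : H.natDegree ≤ k) (hH0 : H ≠ 0) :
    {o : Option F | Zc F F i0 j0 k H o}.ncard ≤ min (Fintype.card F + 1) (k + dl i0 + dl j0) := by
  classical
  refine le_min ?_ ?_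
  · have := Set.ncard_le_card {o : Option F | Zc F F i0 j0 k H o}
    rwa [Nat.card_eq_fintype_card, Fintype.card_option] at this
  · let A : Finset F := if i0 = 0 then ∅ else {0}
    let B : Finset (Option F) := if j0 ≠ 0 ∨ H.coeff k = 0 then {none} else ∅
    have hsub : {o : Option F | Zc F F i0 j0 k H o} ⊆
        (((H.roots.toFinset ∪ A).image some ∪ B : Finset (Option F)) : Set (Option F)) := by
      intro o ho
      rw [Finset.mem_coe, Finset.mem_union]
      cases o with
      | none =>
        right
        simp only [B]
        rw [if_pos (show j0 ≠ 0 ∨ H.coeff k = 0 from ho)]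
        exact Finset.mem_singleton_self _
      | some t =>
        left
        apply Finset.mem_image_of_mem
        rw [Finset.mem_union]
        rcases ho with ⟨h1, h2⟩ | h
        · right
          simp [A, h1, h2]
        · left
          rw [Multiset.mem_toFinset, Polynomial.mem_roots hH0]
          simpa using h
    have h1 := Set.ncard_le_ncard hsub (Finset.finite_toSet _)
    rw [Set.ncard_coe_finset] at h1
    have h2 := Finset.card_union_le ((H.roots.toFinset ∪ A).image some) B
    have h3 : ((H.roots.toFinset ∪ A).image some).card ≤ _ := Finset.card_image_le
    have h4 := Finset.card_union_le H.roots.toFinset A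
    have h5 := (Multiset.toFinset_card_le H.roots).trans (Polynomial.card_roots' H)
    have hA : A.card = dl i0 := by
      simp only [A, dl]
      split_ifs <;> simp
    have hB : H.natDegree + B.card ≤ k + dl j0 := by
      simp only [B, dl]
      by_cases hj : j0 = 0
      · by_cases hc : H.coeff k = 0
        · have : H.natDegree ≠ k := by
            intro h
            rw [← h] at hc
            exact hH0 (Polynomial.leadingCoeff_eq_zero.1 hc)
          simp [hj, hc]
          omega
        · simp [hj, hc, hH]
      · simp [hj, hH]
    omega

theorem Z_lower (F : Type) [Field F] [Fintype F] (i0 j0 k : ℕ) :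
    ∃ H : Polynomial F, H.natDegree ≤ k ∧ H ≠ 0 ∧
      min (Fintype.card F + 1) (k + dl i0 + dl j0) ≤
        {o : Option F | Zc F F i0 j0 k H o}.ncard := by
  classical
  have hq : 1 < Fintype.card F := Fintype.one_lt_card
  let A : Finset (Option F) := if i0 = 0 then ∅ else {some 0}
  let B : Finset (Option F) := if j0 = 0 then ∅ else {none}
  have hA : A.card = dl i0 := by
    simp only [A, dl]
    split_ifs <;> simp
  have hB : B.card = dl j0 := by
    simp only [B, dl]
    split_ifs <;> simp
  have hdis : Disjoint A B := by
    simp only [A, B]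
    split_ifs <;> simp
  have hAB : (A ∪ B).card = dl i0 + dl j0 := by
    rw [Finset.card_union_of_disjoint hdis, hA, hB]
  have hd1 : ∀ n, dl n ≤ 1 := by
    intro n
    unfold dl
    split_ifs <;> simp
  have hdi := hd1 i0
  have hdj := hd1 j0
  obtain ⟨T, hT1, -, hT2⟩ := Finset.exists_subsuperset_card_eq
    (n := min (Fintype.card F + 1) (k + dl i0 + dl j0)) (Finset.subset_univ (A ∪ B))
    (by rw [hAB]; apply le_min <;> omega)
    (by rw [Finset.card_univ, Fintype.card_option]; exact min_le_left _ _)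
  have hTc : (T \ (A ∪ B)).card ≤ k := by
    rw [Finset.card_sdiff_of_subset hT1, hT2, hAB]
    have := min_le_right (Fintype.card F + 1) (k + dl i0 + dl j0)
    omega
  set T' := T \ (A ∪ B) with hT'
  let R : Finset F := Finset.univ.filter fun t => some t ∈ T'
  have hdeg : (∏ t ∈ R, (Polynomial.X - Polynomial.C t)).natDegree = R.card := by
    rw [Polynomial.natDegree_prod_of_monic _ _ fun t _ => Polynomial.monic_X_sub_C t]
    simp
  have hRim : R.image some ⊆ T' := by
    intro o ho
    obtain ⟨t, ht, rfl⟩ := Finset.mem_image.1 ho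
    exact (Finset.mem_filter.1 ht).2
  have hRc : (R.image some).card = R.card :=
    Finset.card_image_of_injective _ (Option.some_injective F)
  have hR : R.card ≤ k := by
    rw [← hRc]
    exact (Finset.card_le_card hRim).trans hTc
  refine ⟨∏ t ∈ R, (Polynomial.X - Polynomial.C t), hdeg.le.trans hR,
    (Polynomial.monic_prod_of_monic _ _ fun t _ => Polynomial.monic_X_sub_C t).ne_zero, ?_⟩
  rw [← hT2, ← Set.ncard_coe_finset]
  refine Set.ncard_le_ncard ?_ (Set.toFinite _)
  intro o ho
  have ho : o ∈ T := ho
  have hcase : o ∈ T' ∨ o ∈ A ∨ o ∈ B := by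
    rw [hT', Finset.mem_sdiff, Finset.mem_union]
    tauto
  change Zc F F i0 j0 k _ o
  cases o with
  | none =>
    rcases hcase with h | h | h
    · right
      apply Polynomial.coeff_eq_zero_of_natDegree_lt
      rw [hdeg]
      have : insert none (R.image some) ⊆ T' := Finset.insert_subset h hRim
      have := Finset.card_le_card this
      rw [Finset.card_insert_of_notMem (by simp), hRc] at this
      omega
    · simp only [A] at h
      split_ifs at h <;> simp at h
    · left
      intro hj
      simp [B, hj] at h
  | some t =>
    rcases hcase with h | h | h
    · right
      rw [map_prod]
      apply Finset.prod_eq_zero (i := t)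
      · exact Finset.mem_filter.2 ⟨Finset.mem_univ _, h⟩
      · simp
    · left
      simp only [A] at h
      split_ifs at h with hi
      · simp at h
      · exact ⟨hi, by simpa using h⟩
    · simp only [B] at h
      split_ifs at h <;> simp at h

theorem eMax_core (F : Type) [Field F] [Fintype F] (g a b i0 j0 k d : ℕ) (hg : 0 < g)
    (ha : 0 < a) (hb : 0 < b) (hab : Nat.Coprime a b)
    (hd : d = g * a * i0 + g * b * j0 + k * (g * a * b))
    (hchar : ∀ i j, g * a * i + g * b * j = d → ∃ m ≤ k, i = i0 + b * m ∧ j = j0 + a * (k - m)) :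
    eMax F ![g * a, g * b] d = min (Fintype.card F + 1) (k + dl i0 + dl j0) := by
  unfold eMax
  have hup : ∀ n ∈ {n | ∃ f : MvPolynomial (Fin (1 + 1)) F,
    f ≠ 0 ∧ MvPolynomial.IsWeightedHomogeneous ![g * a, g * b] f d ∧
      n = (vanishSet F ![g * a, g * b] f).ncard},
      n ≤ min (Fintype.card F + 1) (k + dl i0 + dl j0) := by
    rintro n ⟨f, hf0, hf, rfl⟩
    obtain ⟨H, hH, rfl⟩ := exists_polyOf F g a b i0 j0 k d hb hchar f hf
    rw [ncard_vanish F g a b i0 j0 k hg ha hb hab H hH]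
    apply Z_upper F i0 j0 k H hH
    rintro rfl
    apply hf0
    simp [polyOf]
  obtain ⟨H, hH, hH0, hle⟩ := Z_lower F i0 j0 k
  have hmem : {o : Option F | Zc F F i0 j0 k H o}.ncard ∈
      {n | ∃ f : MvPolynomial (Fin (1 + 1)) F,
    f ≠ 0 ∧ MvPolynomial.IsWeightedHomogeneous ![g * a, g * b] f d ∧
      n = (vanishSet F ![g * a, g * b] f).ncard} := by
    refine ⟨polyOf F a b i0 j0 k H, ?_, ?_, ?_⟩
    · intro h
      have h2 := coeff_polyOf F a b i0 j0 k hb H H.natDegree hH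
      rw [h, MvPolynomial.coeff_zero] at h2
      exact hH0 (Polynomial.leadingCoeff_eq_zero.1 h2.symm)
    · rw [hd]
      exact polyOf_hom F g a b i0 j0 k H
    · rw [ncard_vanish F g a b i0 j0 k hg ha hb hab H hH]
  apply le_antisymm
  · exact csSup_le ⟨_, hmem⟩ hup
  · exact hle.trans (le_csSup ⟨_, hup⟩ hmem)

theorem char_sol (g a b i1 j1 : ℕ) (hg : 0 < g) (ha : 0 < a) (hb : 0 < b)
    (hab : Nat.Coprime a b) (i j : ℕ) (h : g * a * i + g * b * j = g * a * i1 + g * b * j1) :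
    ∃ m ≤ i1 / b + j1 / a, i = i1 % b + b * m ∧ j = j1 % a + a * (i1 / b + j1 / a - m) := by
  have h' : a * i + b * j = a * i1 + b * j1 := by
    apply Nat.eq_of_mul_eq_mul_left hg
    linarith
  have hi : i % b = i1 % b := by
    have : a * i ≡ a * i1 [MOD b] := by
      have h3 : (a * i + b * j) % b = (a * i1 + b * j1) % b := by rw [h']
      simpa [Nat.ModEq] using h3
    exact Nat.ModEq.cancel_left_of_coprime (by rw [Nat.gcd_comm]; exact hab) this
  have hj : j % a = j1 % a := by
    have : b * j ≡ b * j1 [MOD a] := by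
      have h3 : (a * i + b * j) % a = (a * i1 + b * j1) % a := by rw [h']
      simpa [Nat.ModEq] using h3
    exact Nat.ModEq.cancel_left_of_coprime hab this
  have e1 := Nat.mod_add_div i b
  have e2 := Nat.mod_add_div j a
  have e3 := Nat.mod_add_div i1 b
  have e4 := Nat.mod_add_div j1 a
  have hk : i / b + j / a = i1 / b + j1 / a := by
    apply Nat.eq_of_mul_eq_mul_left (Nat.mul_pos ha hb)
    rw [hi] at e1
    rw [hj] at e2
    rw [← e1, ← e2, ← e3, ← e4] at h'
    simp only [Nat.add_mul_mod_self_left, Nat.mod_mod] at h'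
    rw [e1, e2, e3, e4] at h'
    nlinarith
  refine ⟨i / b, hk ▸ Nat.le_add_right _ _, by rw [← hi, e1], ?_⟩
  rw [← hk, Nat.add_sub_cancel_left, ← hj, e2]

theorem main_core (F : Type) [Field F] [Fintype F] (g a b : ℕ) (hg : 0 < g)
    (ha : 0 < a) (hb : 0 < b) (hab : Nat.Coprime a b)
    (d : ℕ) (hd : ∃ i0 i1 : ℕ, d = g * a * i0 + g * b * i1)
    (lam rho : ℕ) (hdiv : d = lam * (g * a * b) + rho)
    (hrho : rho < g * a * b) :
    ((g * a ∣ d ∧ g * b ∣ d) →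
      eMax F ![g * a, g * b] d = min (Fintype.card F + 1) lam) ∧
    (((g * a ∣ d ∧ ¬ g * b ∣ d) ∨ (¬ g * a ∣ d ∧ g * b ∣ d)) →
      eMax F ![g * a, g * b] d = min (Fintype.card F + 1) (lam + 1)) ∧
    ((¬ g * a ∣ d ∧ ¬ g * b ∣ d) →
      eMax F ![g * a, g * b] d =
        min (Fintype.card F + 1) (lam + 1 + den (g * a) (g * b) rho)) := by
  obtain ⟨i1, j1, hd⟩ := hd
  have hchar := fun i j (h : g * a * i + g * b * j = d) =>
    char_sol g a b i1 j1 hg ha hb hab i j (h.trans hd)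
  have hi0 : i1 % b < b := Nat.mod_lt _ hb
  have hj0 : j1 % a < a := Nat.mod_lt _ ha
  have hdk : d = g * a * (i1 % b) + g * b * (j1 % a) + (i1 / b + j1 / a) * (g * a * b) := by
    rw [hd]
    conv_lhs => rw [← Nat.mod_add_div i1 b, ← Nat.mod_add_div j1 a]
    ring
  generalize i1 % b = i0 at *
  generalize j1 % a = j0 at *
  generalize i1 / b + j1 / a = k at *
  have hL : 0 < g * a * b := by positivity
  rw [eMax_core F g a b i0 j0 k d hg ha hb hab hdk hchar]
  have hda : g * a ∣ d ↔ j0 = 0 := by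
    constructor
    · rintro ⟨c, hc⟩
      obtain ⟨m, -, -, hm⟩ := hchar c 0 (by rw [hc]; ring)
      omega
    · rintro rfl
      exact ⟨i0 + k * b, by rw [hdk]; ring⟩
  have hdb : g * b ∣ d ↔ i0 = 0 := by
    constructor
    · rintro ⟨c, hc⟩
      obtain ⟨m, -, hm, -⟩ := hchar 0 c (by rw [hc]; ring)
      omega
    · rintro rfl
      exact ⟨j0 + k * a, by rw [hdk]; ring⟩
  have hA : g * a * i0 < g * a * b := Nat.mul_lt_mul_of_pos_left hi0 (by positivity)
  have hB : g * b * j0 < g * a * b := by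
    calc g * b * j0 < g * b * a := Nat.mul_lt_mul_of_pos_left hj0 (by positivity)
      _ = _ := by ring
  have huniq : ∀ s, s < g * a * b → d = k * (g * a * b) + s → lam = k ∧ rho = s := by
    intro s hs h
    have hl : lam = k := by
      have h1 : d / (g * a * b) = lam := by
        rw [hdiv, mul_comm, Nat.mul_add_div hL, Nat.div_eq_of_lt hrho, add_zero]
      have h2 : d / (g * a * b) = k := by
        rw [h, mul_comm, Nat.mul_add_div hL, Nat.div_eq_of_lt hs, add_zero]
      rw [← h1, h2]
    refine ⟨hl, ?_⟩
    rw [hl] at hdiv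
    omega
  rw [hda, hdb]
  refine ⟨?_, ?_, ?_⟩
  · rintro ⟨rfl, rfl⟩
    obtain ⟨rfl, -⟩ := huniq 0 hL (by rw [hdk]; ring)
    simp [dl]
  · rintro (⟨rfl, h⟩ | ⟨h, rfl⟩)
    · obtain ⟨rfl, -⟩ := huniq _ hA (by rw [hdk]; ring)
      simp [dl, h]
    · obtain ⟨rfl, -⟩ := huniq _ hB (by rw [hdk]; ring)
      simp [dl, h]
  · rintro ⟨hj, hi⟩
    congr 1
    simp only [dl, hi, hj, if_false]
    by_cases hs : g * a * i0 + g * b * j0 < g * a * b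
    · obtain ⟨rfl, hr⟩ := huniq _ hs (by rw [hdk]; ring)
      have : den (g * a) (g * b) rho = 1 := by
        unfold den
        rw [Set.ncard_eq_one]
        refine ⟨(i0, j0), ?_⟩
        ext ⟨i, j⟩
        simp only [Set.mem_ofPred_eq, Set.mem_singleton_iff, Prod.mk.injEq]
        constructor
        · intro h
          obtain ⟨m, hm, h1, h2⟩ := hchar (i + b * lam) j (by rw [hdiv, ← h]; ring)
          obtain ⟨n, hn, h3, h4⟩ := hchar i (j + a * lam) (by rw [hdiv, ← h]; ring)
          have hm' : m = lam := by
            by_contra hne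
            have : b * (m + 1) ≤ b * lam := Nat.mul_le_mul_left b (by omega)
            rw [mul_add] at this
            omega
          rw [hm', Nat.sub_self] at h2
          rw [hm'] at h1
          omega
        · rintro ⟨rfl, rfl⟩
          exact hr.symm
      omega
    · have hlk : lam = k + 1 := by
        have h1 : d / (g * a * b) = lam := by
          rw [hdiv, mul_comm, Nat.mul_add_div hL, Nat.div_eq_of_lt hrho, add_zero]
        have h2 : d / (g * a * b) = k + 1 := by
          have : d = g * a * b * (k + 1) + (g * a * i0 + g * b * j0 - g * a * b) := by
            rw [hdk, mul_add]
            have : k * (g * a * b) = g * a * b * k := mul_comm _ _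
            omega
          rw [this, Nat.mul_add_div hL, Nat.div_eq_of_lt (by omega), add_zero]
        rw [← h1, h2]
      have : den (g * a) (g * b) rho = 0 := by
        unfold den
        have : {p : ℕ × ℕ | g * a * p.1 + g * b * p.2 = rho} = ∅ := by
          rw [Set.eq_empty_iff_forall_notMem]
          rintro ⟨i, j⟩ h
          have h : g * a * i + g * b * j = rho := h
          obtain ⟨m, hm, h1, h2⟩ := hchar (i + b * lam) j (by rw [hdiv, ← h]; ring)
          have : b * (m + 1) ≤ b * lam := Nat.mul_le_mul_left b (by omega)
          rw [mul_add] at this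
          omega
        rw [this, Set.ncard_empty]
      omega

/-- Corollary 4.3 of the paper: exact value of `e_q(d; w_0, w_1)`. -/
theorem stmt14 (F : Type) [Field F] [Fintype F] (w0 w1 : ℕ) (h0 : 0 < w0) (h1 : 0 < w1)
    (d : ℕ) (hd : ∃ i0 i1 : ℕ, d = w0 * i0 + w1 * i1)
    (lam rho : ℕ) (hdiv : d = lam * Nat.lcm w0 w1 + rho)
    (hrho : rho < Nat.lcm w0 w1) :
    ((w0 ∣ d ∧ w1 ∣ d) →
      eMax F ![w0, w1] d = min (Fintype.card F + 1) lam) ∧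
    (((w0 ∣ d ∧ ¬ w1 ∣ d) ∨ (¬ w0 ∣ d ∧ w1 ∣ d)) →
      eMax F ![w0, w1] d = min (Fintype.card F + 1) (lam + 1)) ∧
    ((¬ w0 ∣ d ∧ ¬ w1 ∣ d) →
      eMax F ![w0, w1] d = min (Fintype.card F + 1) (lam + 1 + den w0 w1 rho)) := by
  obtain ⟨a, b, hab, e0, e1⟩ := Nat.exists_coprime w0 w1
  have hg : 0 < Nat.gcd w0 w1 := Nat.gcd_pos_of_pos_left _ h0
  generalize Nat.gcd w0 w1 = g at *
  rw [mul_comm] at e0 e1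
  subst e0 e1
  have ha : 0 < a := Nat.pos_of_mul_pos_left h0
  have hb : 0 < b := Nat.pos_of_mul_pos_left h1
  have hl : Nat.lcm (g * a) (g * b) = g * a * b := by
    rw [Nat.lcm_mul_left, hab.lcm_eq_mul, mul_assoc]
  rw [hl] at hdiv hrho
  exact main_core F g a b hg ha hb hab d hd lam rho hdiv hrho

end
end

section
/- Let q be a prime power, m ≥ 2, and let w = (w_0, w_1, …, w_m) be a weight vector of positive integers with w_1 ≤ w_2 ≤ ⋯ ≤ w_m. Assume gcd(w_0, w_i, q − 1) = 1 for all 1 ≤ i ≤ m. Then for every d ≥ 1, e_q(d; w_0, w_1, …, w_m) ≤ min{ p_m, (⌊(d−1)/w_1⌋ + 1)·q^{m−1} + p_{m−2} }. -/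
open MvPolynomial

noncomputable section

/-- number of nonzeros in affine space -/
def NZ {F : Type} [Field F] [Fintype F] {n : ℕ} (f : MvPolynomial (Fin n) F) : ℤ :=
  open Classical in ∑ x : Fin n → F, if eval x f ≠ 0 then 1 else 0

/-- number of nonzeros on the line over y -/
def fibNZ {F : Type} [Field F] [Fintype F] {n : ℕ} (f : MvPolynomial (Fin (n+1)) F)
    (y : Fin n → F) : ℤ :=
  open Classical in ∑ t : F, if eval (Fin.cons t y : Fin (n+1) → F) f ≠ 0 then 1 else 0

lemma NZ_eq_fib {F : Type} [Field F] [Fintype F] {n : ℕ} (f : MvPolynomial (Fin (n+1)) F) :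
    NZ f = ∑ y : Fin n → F, fibNZ f y := by
  classical
  unfold NZ fibNZ
  rw [Finset.sum_comm, ← Fintype.sum_prod_type']
  exact (Fintype.sum_equiv (Fin.consEquiv (fun _ : Fin (n+1) => F)) _ _ (fun x => rfl)).symm

lemma fibNZ_nonneg {F : Type} [Field F] [Fintype F] {n : ℕ} (f : MvPolynomial (Fin (n+1)) F)
    (y : Fin n → F) : 0 ≤ fibNZ f y := by
  classical
  unfold fibNZ
  apply Finset.sum_nonneg
  intros
  split_ifs <;> simp

lemma fibNZ_ge {F : Type} [Field F] [Fintype F] {n : ℕ} (f : MvPolynomial (Fin (n+1)) F)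
    (y : Fin n → F) (h : eval y (finSuccEquiv F n f).leadingCoeff ≠ 0) :
    (Fintype.card F : ℤ) - (finSuccEquiv F n f).natDegree ≤ fibNZ f y := by
  classical
  unfold fibNZ
  set P := Polynomial.map (eval y) (finSuccEquiv F n f) with hP
  have hP0 : P ≠ 0 := by
    intro h0
    apply h
    have : P.coeff (finSuccEquiv F n f).natDegree = 0 := by rw [h0]; simp
    rwa [hP, Polynomial.coeff_map] at this
  have hdeg : P.natDegree ≤ (finSuccEquiv F n f).natDegree := Polynomial.natDegree_map_le
  have hz : (Finset.univ.filter (fun t : F => P.eval t = 0)).card ≤ P.natDegree := by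
    refine le_trans (Finset.card_le_card ?_) (le_trans (Multiset.toFinset_card_le _) (Polynomial.card_roots' P))
    intro t ht
    simp at ht
    simp [hP0, ht]
  have hsplit := Finset.card_filter_add_card_filter_not (s := (Finset.univ : Finset F)) (fun t : F => P.eval t = 0)
  simp only [eval_eq_eval_mv_eval']
  rw [← hP, Finset.sum_boole]
  rw [Finset.card_univ] at hsplit
  have : (Finset.univ.filter (fun t : F => ¬ P.eval t = 0)) = (Finset.univ.filter (fun t : F => P.eval t ≠ 0)) := rfl
  rw [this] at hsplit
  omega

lemma NZ_peel {F : Type} [Field F] [Fintype F] {n : ℕ} (f : MvPolynomial (Fin (n+1)) F) :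
    ((Fintype.card F : ℤ) - (finSuccEquiv F n f).natDegree) *
      NZ (finSuccEquiv F n f).leadingCoeff ≤ NZ f := by
  classical
  rw [NZ_eq_fib f]
  conv_lhs => unfold NZ
  rw [Finset.mul_sum]
  apply Finset.sum_le_sum
  intro y _
  split_ifs with h
  · simpa using fibNZ_ge f y h
  · simpa using fibNZ_nonneg f y

lemma weight_cons {n : ℕ} (w : Fin (n+1) → ℕ) (s : Fin n →₀ ℕ) (j : ℕ) :
    Finsupp.weight w (s.cons j) = j * w 0 + Finsupp.weight (fun i : Fin n => w i.succ) s := by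
  rw [Finsupp.weight_apply, Finsupp.weight_apply, Finsupp.sum_fintype _ _ (by simp),
    Finsupp.sum_fintype _ _ (by simp), Fin.sum_univ_succ]
  simp

lemma coeff_weight {F : Type} [Field F] {n : ℕ} {w : Fin (n+1) → ℕ} {d : ℕ}
    {f : MvPolynomial (Fin (n+1)) F} (hf : IsWeightedHomogeneous w f d) (j : ℕ)
    (s : Fin n →₀ ℕ) (hs : coeff s ((finSuccEquiv F n f).coeff j) ≠ 0) :
    j * w 0 + Finsupp.weight (fun i : Fin n => w i.succ) s = d := by
  rw [finSuccEquiv_coeff_coeff] at hs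
  rw [← weight_cons]
  exact hf hs

lemma coeff_hom {F : Type} [Field F] {n : ℕ} {w : Fin (n+1) → ℕ} {d : ℕ}
    {f : MvPolynomial (Fin (n+1)) F} (hf : IsWeightedHomogeneous w f d) (j : ℕ) :
    IsWeightedHomogeneous (fun i : Fin n => w i.succ) ((finSuccEquiv F n f).coeff j) (d - j * w 0) := by
  intro s hs
  have := coeff_weight hf j s hs
  omega

lemma coeff_le {F : Type} [Field F] {n : ℕ} {w : Fin (n+1) → ℕ} {d : ℕ}
    {f : MvPolynomial (Fin (n+1)) F} (hf : IsWeightedHomogeneous w f d) (j : ℕ)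
    (hj : (finSuccEquiv F n f).coeff j ≠ 0) : j * w 0 ≤ d := by
  obtain ⟨s, hs⟩ := MvPolynomial.ne_zero_iff.1 hj
  have := coeff_weight hf j s hs
  omega

lemma weight_zero_eq {n : ℕ} {w : Fin n → ℕ} (hw : ∀ i, 1 ≤ w i) (s : Fin n →₀ ℕ)
    (h : Finsupp.weight w s = 0) : s = 0 := by
  rw [Finsupp.weight_apply, Finsupp.sum_fintype _ _ (by simp)] at h
  ext i
  have := (Finset.sum_eq_zero_iff.1 h) i (Finset.mem_univ i)
  have h1 := hw i
  simp only [smul_eq_mul, mul_eq_zero] at this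
  simp
  omega

lemma hom_zero_const {F : Type} [Field F] {n : ℕ} {w : Fin n → ℕ} (hw : ∀ i, 1 ≤ w i)
    {g : MvPolynomial (Fin n) F} (hg : IsWeightedHomogeneous w g 0) : g = C (coeff 0 g) := by
  ext s
  rw [coeff_C]
  split_ifs with h
  · rw [h]
  · by_contra h'
    exact h (weight_zero_eq hw s (hg h')).symm

lemma hom_pos_eval_zero {F : Type} [Field F] {n : ℕ} {w : Fin n → ℕ} {d : ℕ} (hd : 1 ≤ d)
    {g : MvPolynomial (Fin n) F} (hg : IsWeightedHomogeneous w g d) : eval 0 g = 0 := by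
  rw [MvPolynomial.eval_zero]
  by_contra h
  have := hg (d := 0) h
  simp at this
  omega

lemma base_case {F : Type} [Field F] [Fintype F] {w : Fin 1 → ℕ} {d : ℕ} (hw : ∀ i, 1 ≤ w i)
    {f : MvPolynomial (Fin 1) F} (hf : IsWeightedHomogeneous w f d) (hf0 : f ≠ 0) :
    (Fintype.card F : ℤ) - 1 ≤ NZ f := by
  classical
  obtain ⟨s, hs⟩ := MvPolynomial.ne_zero_iff.1 hf0
  have hwt : ∀ t : Fin 1 →₀ ℕ, Finsupp.weight w t = t 0 * w 0 := by
    intro t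
    rw [Finsupp.weight_apply, Finsupp.sum_fintype _ _ (by simp)]
    simp
  have hfm : f = monomial s (coeff s f) := by
    ext t
    rw [coeff_monomial]
    split_ifs with h
    · rw [h]
    · by_contra h'
      apply h
      have h1 := hf hs
      have h2 := hf h'
      rw [hwt] at h1 h2
      rw [← h2] at h1
      ext
      exact Nat.eq_of_mul_eq_mul_right (hw 0) h1
  have hev : ∀ x : Fin 1 → F, x 0 ≠ 0 → eval x f ≠ 0 := by
    intro x hx
    rw [hfm, eval_monomial]
    apply mul_ne_zero hs
    rw [Finsupp.prod_fintype _ _ (by simp)]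
    simp [hx]
  unfold NZ
  have e := Fintype.sum_equiv (Equiv.funUnique (Fin 1) F).symm
    (fun t : F => if eval (fun _ => t) f ≠ 0 then (1:ℤ) else 0)
    (fun x => if eval x f ≠ 0 then (1:ℤ) else 0) (fun x => rfl)
  rw [← e]
  calc (Fintype.card F : ℤ) - 1 = ∑ t : F, (1 - if t = 0 then (1:ℤ) else 0) := by
        rw [Finset.sum_sub_distrib]; simp
    _ ≤ _ := by
        apply Finset.sum_le_sum
        intro t _
        by_cases ht : t = 0
        · simp only [ht, if_true]; split_ifs <;> simp
        · rw [if_neg ht, if_pos (hev _ ht)]; simp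

/-- shear substitution -/
def shear {F : Type} [Field F] {n : ℕ} (c : Fin (n+1) → F) (f : MvPolynomial (Fin (n+1)) F) :
    MvPolynomial (Fin (n+1)) F :=
  bind₁ (fun i => X i + C (c i) * X 0) f

lemma eval_shear {F : Type} [Field F] {n : ℕ} (c : Fin (n+1) → F) (f : MvPolynomial (Fin (n+1)) F)
    (x : Fin (n+1) → F) : eval x (shear c f) = eval (fun i => x i + c i * x 0) f := by
  unfold shear
  have := eval₂Hom_bind₁ (RingHom.id F) x (fun i => X i + C (c i) * X 0) f
  refine this.trans ?_
  change eval (fun i => eval x (X i + C (c i) * X 0)) f = _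
  simp

lemma shear_shear {F : Type} [Field F] {n : ℕ} (c : Fin (n+1) → F) (hc : 1 + c 0 ≠ 0)
    (f : MvPolynomial (Fin (n+1)) F) :
    shear (fun i => - c i / (1 + c 0)) (shear c f) = f := by
  unfold shear
  rw [bind₁_bind₁]
  have : (fun i => (bind₁ fun i => X i + C (-c i / (1 + c 0)) * X 0) (X i + C (c i) * X 0))
      = (X : Fin (n+1) → MvPolynomial (Fin (n+1)) F) := by
    funext i
    simp only [map_add, map_mul, bind₁_X_right, bind₁_C_right]
    have h : -c i / (1 + c 0) + c i * (1 + -c 0 / (1 + c 0)) = 0 := by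
      field_simp; ring
    have h2 : (C (-c i / (1 + c 0)) + C (c i) * (1 + C (-c 0 / (1 + c 0))) : MvPolynomial (Fin (n+1)) F) = 0 := by
      rw [← C_1, ← C_add, ← C_mul, ← C_add, h, C_0]
    linear_combination (X 0) * h2
  rw [this, bind₁_X_left]
  rfl

lemma shear_ne_zero {F : Type} [Field F] {n : ℕ} (c : Fin (n+1) → F) (hc : 1 + c 0 ≠ 0)
    {f : MvPolynomial (Fin (n+1)) F} (hf : f ≠ 0) : shear c f ≠ 0 := by
  intro h
  apply hf
  rw [← shear_shear c hc f, h]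
  simp [shear]

lemma NZ_shear {F : Type} [Field F] [Fintype F] {n : ℕ} (c : Fin (n+1) → F) (hc : 1 + c 0 ≠ 0)
    (f : MvPolynomial (Fin (n+1)) F) : NZ (shear c f) = NZ f := by
  classical
  unfold NZ
  have hinj : Function.Injective (fun (x : Fin (n+1) → F) i => x i + c i * x 0) := by
    intro x y h
    have h0 := congrFun h 0
    simp only at h0
    have h0' : x 0 = y 0 := by
      apply mul_left_cancel₀ hc
      linear_combination h0
    funext i
    have hi := congrFun h i
    simp only [h0'] at hi
    exact add_right_cancel hi
  have hb := Finite.injective_iff_bijective.1 hinj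
  refine Fintype.sum_bijective _ hb _ _ ?_
  intro x
  rw [eval_shear]

lemma shear_hom {F : Type} [Field F] {n : ℕ} (c : Fin (n+1) → F) {w : Fin (n+1) → ℕ} {d : ℕ}
    (hc : ∀ i, c i ≠ 0 → w i = w 0)
    {f : MvPolynomial (Fin (n+1)) F} (hf : IsWeightedHomogeneous w f d) :
    IsWeightedHomogeneous w (shear c f) d := by
  have key : shear c f = ∑ s ∈ f.support, C (coeff s f) *
      ∏ i, (X i + C (c i) * X 0) ^ (s i) := by
    conv_lhs => rw [shear, ← support_sum_monomial_coeff f, map_sum]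
    refine Finset.sum_congr rfl fun s _ => ?_
    rw [bind₁_monomial]
    congr 1
    exact Finset.prod_subset (Finset.subset_univ _) (by intro i _ h; simp at h; simp [h])
  rw [key]
  apply IsWeightedHomogeneous.sum
  intro s hs
  apply IsWeightedHomogeneous.C_mul
  have hw : d = ∑ i, s i • w i := by
    rw [← hf (mem_support_iff.1 hs), Finsupp.weight_apply, Finsupp.sum_fintype _ _ (by simp)]
  rw [hw]
  apply IsWeightedHomogeneous.prod
  intro i _
  apply IsWeightedHomogeneous.pow
  apply IsWeightedHomogeneous.add
  · exact isWeightedHomogeneous_X _ _ _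
  · by_cases h : c i = 0
    · rw [h]; simpa using isWeightedHomogeneous_zero _ _ _
    · apply IsWeightedHomogeneous.C_mul
      rw [hc i h]
      exact isWeightedHomogeneous_X _ _ _

/-- value at the unit vector when the leading coefficient is a constant -/
lemma eval_unit {F : Type} [Field F] {n : ℕ} {w : Fin (n+1) → ℕ} {d : ℕ}
    (hw : ∀ i, 1 ≤ w i) {f : MvPolynomial (Fin (n+1)) F} (hf0 : f ≠ 0)
    (hf : IsWeightedHomogeneous w f d)
    (hk : (finSuccEquiv F n f).natDegree * w 0 = d) :
    eval (Fin.cons 1 0 : Fin (n+1) → F) f ≠ 0 := by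
  set P := finSuccEquiv F n f with hP
  have hP0 : P ≠ 0 := by simpa [hP] using hf0
  have hg : IsWeightedHomogeneous (fun i : Fin n => w i.succ) P.leadingCoeff 0 := by
    have := coeff_hom hf P.natDegree
    rw [hk, Nat.sub_self] at this
    exact this
  have hgc := hom_zero_const (fun i => hw i.succ) hg
  have hc : eval 0 P.leadingCoeff ≠ 0 := by
    have : P.leadingCoeff ≠ 0 := Polynomial.leadingCoeff_ne_zero.2 hP0
    rw [hgc] at this ⊢
    intro h
    apply this
    rw [eval_C] at h
    rw [h, C_0]
  rw [eval_eq_eval_mv_eval', ← hP, Polynomial.eval_map, Polynomial.eval₂_eq_sum_range,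
    Finset.sum_range_succ, Finset.sum_eq_zero, zero_add]
  · simpa using hc
  · intro j hj
    rw [Finset.mem_range] at hj
    have h1 := coeff_hom hf j
    have : j * w 0 < d := by
      rw [← hk]; exact Nat.mul_lt_mul_of_pos_right hj (hw 0)
    rw [hom_pos_eval_zero (by omega) h1]
    simp

lemma core {F : Type} [Field F] [Fintype F] (n : ℕ) : ∀ (w : Fin (n+1) → ℕ) (u B d : ℕ)
    (f : MvPolynomial (Fin (n+1)) F), (∀ i, 1 ≤ w i) → (∀ i, i ≠ Fin.last n → u ≤ w i) →
    (∀ i j, i ≤ j → j ≠ Fin.last n → w j ≤ w i) → 1 ≤ d → d ≤ B * u → B ≤ Fintype.card F →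
    f ≠ 0 → IsWeightedHomogeneous w f d →
    (Fintype.card F : ℤ) ^ n * ((Fintype.card F - 1) * (Fintype.card F + 1 - B)) ≤
      Fintype.card F * NZ f := by
  have hq1 : (1:ℤ) ≤ (Fintype.card F : ℤ) := by exact_mod_cast Fintype.card_pos
  set q : ℤ := (Fintype.card F : ℤ) with hq
  induction n with
  | zero =>
    intro w u B d f hw _ _ hd hB hBq hf0 hf
    have hB1 : 1 ≤ B := by
      rcases Nat.eq_zero_or_pos B with h | h
      · rw [h] at hB; omega
      · exact h
    have h := base_case hw hf hf0
    rw [← hq] at h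
    have hB1' : (1:ℤ) ≤ B := by exact_mod_cast hB1
    nlinarith [mul_nonneg (sub_nonneg.2 hq1) (sub_nonneg.2 hB1')]
  | succ n ih =>
    intro w u B d f hw hu hanti hd hB hBq hf0 hf
    have hBq' : (B:ℤ) ≤ q := by rw [hq]; exact_mod_cast hBq
    have hlast : (0 : Fin (n+2)) ≠ Fin.last (n+1) := by
      intro h; simp [Fin.ext_iff] at h
    have hqn : 0 < q ^ n := by positivity
    have step : ∀ f : MvPolynomial (Fin (n+2)) F, f ≠ 0 → IsWeightedHomogeneous w f d →
        (finSuccEquiv F (n+1) f).natDegree * w 0 < d →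
        q ^ (n+1) * ((q - 1) * (q + 1 - B)) ≤ q * NZ f := by
      intro f hf0 hf hlt
      set P := finSuccEquiv F (n+1) f with hP
      set k := P.natDegree with hk
      have hP0 : P ≠ 0 := by simpa [hP] using hf0
      have hku : k * u ≤ k * w 0 := Nat.mul_le_mul_left _ (hu 0 hlast)
      have hkB : k < B := by
        by_contra h
        have := Nat.mul_le_mul_right u (not_lt.1 h)
        omega
      have hd' : d - k * w 0 ≤ (B - k) * u := by
        rw [Nat.sub_mul]; omega
      have := ih (fun i => w i.succ) u (B - k) (d - k * w 0) P.leadingCoeff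
        (fun i => hw _) (fun i hi => hu _ (by
          intro h; apply hi; rw [← Fin.succ_last] at h; exact Fin.succ_injective _ h))
        (fun i j hij hj => hanti _ _ (Fin.succ_le_succ_iff.2 hij) (by
          intro h; apply hj; rw [← Fin.succ_last] at h; exact Fin.succ_injective _ h))
        (by omega) hd' (by omega) (Polynomial.leadingCoeff_ne_zero.2 hP0) (coeff_hom hf k)
      have hpeel := NZ_peel f
      rw [← hP, ← hk, ← hq] at hpeel
      rw [Nat.cast_sub hkB.le] at this
      have hkB' : (k:ℤ) + 1 ≤ B := by exact_mod_cast hkB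
      have hqk : 0 ≤ q - k := by linarith
      have h1 := mul_le_mul_of_nonneg_left this hqk
      have h2 : q * ((q - k) * NZ P.leadingCoeff) ≤ q * NZ f :=
        mul_le_mul_of_nonneg_left hpeel (by linarith)
      have h3 : 0 ≤ (q ^ n * (q - 1)) * (k * (B - 1 - k)) := by
        apply mul_nonneg (mul_nonneg hqn.le (by linarith))
        exact mul_nonneg (by positivity) (by linarith)
      rw [pow_succ]
      nlinarith
    set P := finSuccEquiv F (n+1) f with hP
    set k := P.natDegree with hk
    have hP0 : P ≠ 0 := by simpa [hP] using hf0
    have hkd : k * w 0 ≤ d := coeff_le hf k (by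
      rw [← hP]; exact Polynomial.leadingCoeff_ne_zero.2 hP0)
    rcases hkd.lt_or_eq with hlt | heq
    · exact step f hf0 hf hlt
    have hku : k * u ≤ k * w 0 := Nat.mul_le_mul_left _ (hu 0 hlast)
    have hu0 : 1 ≤ u := by
      rcases Nat.eq_zero_or_pos u with h | h
      · rw [h] at hB; omega
      · exact h
    have hkB : k ≤ B := by
      have : k * u ≤ B * u := by omega
      exact Nat.le_of_mul_le_mul_right this hu0
    -- the leading coefficient is a nonzero constant
    have hlc : ∀ y, eval y P.leadingCoeff ≠ 0 := by
      have hg : IsWeightedHomogeneous (fun i : Fin (n+1) => w i.succ) P.leadingCoeff 0 := by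
        have := coeff_hom hf k
        rw [heq, Nat.sub_self] at this
        exact this
      have hgc := hom_zero_const (fun i => hw i.succ) hg
      have : P.leadingCoeff ≠ 0 := Polynomial.leadingCoeff_ne_zero.2 hP0
      intro y h
      rw [hgc] at this h
      apply this
      rw [eval_C] at h
      rw [h, C_0]
    have hfib : ∀ y, q - k ≤ fibNZ f y := fun y => fibNZ_ge f y (hlc y)
    rcases hkB.lt_or_eq with hlt | heqB
    · have h1 : q ^ (n+1) * (q - k) ≤ NZ f := by
        rw [NZ_eq_fib]
        calc q ^ (n+1) * (q - k) = ∑ y : Fin (n+1) → F, (q - k) := by simp [hq, mul_sub]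
          _ ≤ _ := Finset.sum_le_sum (fun y _ => hfib y)
      have hlt' : (k:ℤ) + 1 ≤ B := by exact_mod_cast hlt
      have hqn1 : 0 < q ^ (n+1) := by positivity
      have h2 : (q-1) * (q+1-B) ≤ q * (q - k) := by nlinarith
      have h3 := mul_le_mul_of_nonneg_left h2 hqn1.le
      nlinarith
    -- pure power
    have hw0u : w 0 = u := by
      have h1 : k * w 0 ≤ k * u := by rw [heq]; exact hB.trans_eq (by rw [heqB])
      have hk0 : 0 < k := by
        rcases Nat.eq_zero_or_pos k with h | h
        · rw [h] at heq; omega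
        · exact h
      exact le_antisymm (Nat.le_of_mul_le_mul_left h1 hk0) (hu 0 hlast)
    by_cases hv : ∃ v : Fin (n+2) → F, v (Fin.last (n+1)) = 0 ∧ v 0 ≠ 0 ∧ eval v f = 0
    · obtain ⟨v, hvl, hv0, hvf⟩ := hv
      set c : Fin (n+2) → F := fun i => if i = 0 then v 0 - 1 else v i with hc
      have hc0 : 1 + c 0 ≠ 0 := by simp [hc, hv0]
      rw [← NZ_shear c hc0 f]
      have hhom : IsWeightedHomogeneous w (shear c f) d := by
        apply shear_hom c _ hf
        intro i hi
        by_cases hil : i = Fin.last (n+1)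
        · exfalso; apply hi
          rw [hil]
          simp only [hc]
          rw [if_neg hlast.symm, hvl]
        · exact le_antisymm (hanti 0 i (Fin.zero_le _) hil) (hw0u ▸ hu i hil)
      have hne := shear_ne_zero c hc0 hf0
      apply step _ hne hhom
      have hle : (finSuccEquiv F (n+1) (shear c f)).natDegree * w 0 ≤ d := coeff_le hhom _ (by
        apply Polynomial.leadingCoeff_ne_zero.2; simpa using hne)
      refine lt_of_le_of_ne hle fun h => ?_
      apply eval_unit hw hne hhom h
      rw [eval_shear, ← hvf]
      congr 2
      funext i
      refine Fin.cases ?_ (fun j => ?_) i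
      · simp [hc]
      · simp [hc]
    · push Not at hv
      have hfib0 : ∀ y : Fin (n+1) → F, y (Fin.last n) = 0 → q - 1 ≤ fibNZ f y := by
        classical
        intro y hy
        unfold fibNZ
        calc q - 1 = ∑ t : F, (1 - if t = 0 then (1:ℤ) else 0) := by
              rw [Finset.sum_sub_distrib]; simp [hq]
          _ ≤ _ := by
              apply Finset.sum_le_sum
              intro t _
              by_cases ht : t = 0
              · simp only [ht, if_true]; split_ifs <;> simp
              · rw [if_neg ht, if_pos]
                · simp
                · apply hv
                  · rw [← Fin.succ_last, Fin.cons_succ]; exact hy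
                  · simpa using ht
      classical
      have hcount : ∑ y : Fin (n+1) → F, (if y (Fin.last n) = 0 then (1:ℤ) else 0) = q ^ n := by
        have e := Fintype.sum_equiv (Fin.snocEquiv (fun _ : Fin (n+1) => F))
          (fun p => if p.1 = 0 then (1:ℤ) else 0)
          (fun y => if y (Fin.last n) = 0 then (1:ℤ) else 0) (fun p => by simp [Fin.snocEquiv])
        rw [← e, Fintype.sum_prod_type, Finset.sum_comm]
        simp [hq]
      have h1 : q ^ (n+1) * (q - k) + q ^ n * (k - 1) ≤ NZ f := by
        rw [NZ_eq_fib]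
        calc q ^ (n+1) * (q - k) + q ^ n * (k - 1)
            = ∑ y : Fin (n+1) → F, ((q - k) + (if y (Fin.last n) = 0 then (1:ℤ) else 0) * (k-1)) := by
              rw [Finset.sum_add_distrib, ← Finset.sum_mul, hcount]; simp [hq, mul_sub]
          _ ≤ _ := by
              apply Finset.sum_le_sum
              intro y _
              split_ifs with hy
              · have := hfib0 y hy; linarith
              · have := hfib y; linarith
      have hkB' : (k:ℤ) = B := by exact_mod_cast heqB
      rw [hkB'] at h1
      have := mul_le_mul_of_nonneg_left h1 (by linarith : 0 ≤ q)
      refine le_trans (le_of_eq ?_) this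
      ring

lemma wRel_equiv (F : Type) [Field F] {m : ℕ} (w : Fin (m + 1) → ℕ) : Equivalence (wRel F w) where
  refl x := ⟨1, by simp⟩
  symm := by
    rintro x y ⟨l, h⟩
    refine ⟨l⁻¹, fun i => ?_⟩
    rw [h i, ← mul_assoc, ← mul_pow]
    simp
  trans := by
    rintro x y z ⟨l, h⟩ ⟨k, h'⟩
    refine ⟨k * l, fun i => ?_⟩
    rw [h' i, h i, Units.val_mul, mul_pow, mul_assoc]

lemma mk_eq (F : Type) [Field F] {m : ℕ} (w : Fin (m + 1) → ℕ)
    (x y : {v : Fin (m + 1) → AlgebraicClosure F // v ≠ 0}) (h : PW.mk F w x = PW.mk F w y) :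
    wRel F w x y :=
  (wRel_equiv F w).eqvGen_iff.1 (Quot.eqvGen_exact h)

lemma frob_fixed (F : Type) [Field F] [Fintype F] (y : AlgebraicClosure F)
    (h : y ^ Fintype.card F = y) : ∃ a : F, algebraMap F (AlgebraicClosure F) a = y := by
  have hq : 1 < Fintype.card F := Fintype.one_lt_card
  have h1 : (Polynomial.X ^ Fintype.card F - Polynomial.X : Polynomial F)
      = ∏ a : F, (Polynomial.X - Polynomial.C a) := by
    have hs : (Polynomial.X ^ Fintype.card F - Polynomial.X : Polynomial F).roots.card
        = (Polynomial.X ^ Fintype.card F - Polynomial.X : Polynomial F).natDegree := by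
      rw [FiniteField.roots_X_pow_card_sub_X, FiniteField.X_pow_card_sub_X_natDegree_eq F hq]
      simp
    have := Polynomial.prod_multiset_X_sub_C_of_monic_of_roots_card_eq
      (Polynomial.monic_X_pow_sub (by rw [Polynomial.degree_X]; exact_mod_cast hq)) hs
    rw [FiniteField.roots_X_pow_card_sub_X] at this
    exact this.symm
  have h2 := congrArg (Polynomial.aeval y) h1
  simp only [map_sub, map_pow, Polynomial.aeval_X, map_prod, Polynomial.aeval_C] at h2
  rw [h, sub_self] at h2
  obtain ⟨a, -, ha⟩ := Finset.prod_eq_zero_iff.1 h2.symm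
  exact ⟨a, (sub_eq_zero.1 ha).symm⟩

/-- lift to the algebraic closure -/
def lft (F : Type) [Field F] {m : ℕ} (x : {v : Fin (m + 1) → F // v ≠ 0}) :
    {v : Fin (m + 1) → AlgebraicClosure F // v ≠ 0} :=
  ⟨fun i => algebraMap F (AlgebraicClosure F) (x.1 i), by
    intro h
    apply x.2
    funext i
    have := congrFun h i
    simpa using this⟩

lemma exists_rep (F : Type) [Field F] [Fintype F] {m : ℕ} (w : Fin (m + 1) → ℕ)
    (c : PW F w) (hc : c ∈ ratPts F w) : ∃ x, PW.mk F w (lft F x) = c := by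
  obtain ⟨x, hx, h, hx'⟩ := hc
  obtain ⟨l, hl⟩ := mk_eq F w _ _ (hx.trans hx'.symm)
  simp only at hl
  have hq : 1 < Fintype.card F := Fintype.one_lt_card
  obtain ⟨z, hz⟩ := IsAlgClosed.exists_pow_nat_eq ((l⁻¹ : (AlgebraicClosure F)ˣ) : AlgebraicClosure F)
    (n := Fintype.card F - 1) (by omega)
  have hz0 : z ≠ 0 := by
    intro h0
    rw [h0, zero_pow (by omega)] at hz
    exact (l⁻¹).ne_zero hz.symm
  have hzq : z ^ Fintype.card F * l = z := by
    have : Fintype.card F = (Fintype.card F - 1) + 1 := by omega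
    rw [this, pow_succ, hz]
    rw [mul_right_comm]
    simp
  have hfix : ∀ i, ∃ a : F, algebraMap F (AlgebraicClosure F) a = z ^ w i * x.1 i := by
    intro i
    apply frob_fixed
    rw [mul_pow, hl i, ← mul_assoc, ← pow_mul, mul_comm (w i), pow_mul, ← mul_pow, hzq]
  choose a ha using hfix
  have ha0 : a ≠ 0 := by
    intro h0
    apply x.2
    funext i
    have := ha i
    rw [h0] at this
    simpa [hz0] using this.symm
  refine ⟨⟨a, ha0⟩, ?_⟩
  rw [← hx]
  symm
  apply Quot.sound
  exact ⟨Units.mk0 z hz0, fun i => ha i⟩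

lemma pow_unit_eq {F : Type} [Field F] {ι : Type} (S : Finset ι) (hS : S.Nonempty) (w : ι → ℕ)
    (hw : ∀ i, 1 ≤ w i) (t t' : Fˣ) (h : ∀ i ∈ S, t ^ (w i / S.gcd w) = t' ^ (w i / S.gcd w)) :
    t = t' := by
  obtain ⟨i0, hi0⟩ := hS
  have hg := Finset.gcd_div_eq_one (s := S) (f := w) hi0 (by have := hw i0; omega)
  have : orderOf (t / t') ∣ S.gcd (fun i => w i / S.gcd w) := by
    apply Finset.dvd_gcd
    intro i hi
    rw [orderOf_dvd_iff_pow_eq_one, div_pow, h i hi, div_self']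
  rw [hg, Nat.dvd_one, orderOf_eq_one_iff] at this
  exact div_eq_one.1 this

lemma ncard_bound (F : Type) [Field F] [Fintype F] {m : ℕ} (w : Fin (m + 1) → ℕ)
    (hw : ∀ i, 1 ≤ w i) (f : MvPolynomial (Fin (m + 1)) F) :
    (vanishSet F w f).ncard * (Fintype.card F - 1) ≤
      Nat.card {x : Fin (m+1) → F // x ≠ 0 ∧ eval x f = 0} := by
  classical
  have hrep : ∀ c : vanishSet F w f, ∃ x, PW.mk F w (lft F x) = c.1 :=
    fun c => exists_rep F w c.1 c.2.1
  choose r hr using hrep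
  let S : vanishSet F w f → Finset (Fin (m+1)) := fun c => Finset.univ.filter (fun i => (r c).1 i ≠ 0)
  have hS : ∀ c, (S c).Nonempty := by
    intro c
    obtain ⟨i, hi⟩ := Function.ne_iff.1 (r c).2
    exact ⟨i, by simpa [S] using hi⟩
  let φ : vanishSet F w f → Fˣ → (Fin (m+1) → F) :=
    fun c t i => (t : F) ^ (w i / (S c).gcd w) * (r c).1 i
  have hφ0 : ∀ c t, φ c t ≠ 0 := by
    intro c t
    obtain ⟨i, hi⟩ := Function.ne_iff.1 (r c).2
    refine Function.ne_iff.2 ⟨i, ?_⟩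
    simp only [φ]
    exact mul_ne_zero (pow_ne_zero _ t.ne_zero) hi
  have hφc : ∀ c t, PW.mk F w (lft F ⟨φ c t, hφ0 c t⟩) = c.1 := by
    intro c t
    rw [← hr c]
    symm
    apply Quot.sound
    have hg0 : 0 < (S c).gcd w := by
      obtain ⟨i, hi⟩ := hS c
      apply Nat.pos_of_ne_zero
      intro h
      have := Finset.gcd_eq_zero_iff.1 h i hi
      have := hw i
      omega
    obtain ⟨z, hz⟩ := IsAlgClosed.exists_pow_nat_eq (algebraMap F (AlgebraicClosure F) (t:F)) hg0
    have hz0 : z ≠ 0 := by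
      intro h0
      rw [h0, zero_pow (by omega)] at hz
      exact t.ne_zero ((map_eq_zero _).1 hz.symm)
    refine ⟨Units.mk0 z hz0, fun i => ?_⟩
    simp only [lft, φ, map_mul, map_pow, Units.val_mk0]
    by_cases hi : (r c).1 i = 0
    · simp [hi]
    · rw [← hz, ← pow_mul, Nat.mul_div_cancel' (Finset.gcd_dvd (by simpa [S] using hi))]
  have hφf : ∀ c t, eval (φ c t) f = 0 := by
    intro c t
    have := c.2.2 _ (hφc c t)
    simp only [lft] at this
    rw [eval_map] at this
    change eval₂ _ (algebraMap F (AlgebraicClosure F) ∘ φ c t) f = 0 at this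
    rw [← eval₂_comp] at this
    exact (map_eq_zero _).1 this
  let Φ : vanishSet F w f × Fˣ → {x : Fin (m+1) → F // x ≠ 0 ∧ eval x f = 0} :=
    fun p => ⟨φ p.1 p.2, hφ0 _ _, hφf _ _⟩
  have hinj : Function.Injective Φ := by
    rintro ⟨c, t⟩ ⟨c', t'⟩ h
    have h' : φ c t = φ c' t' := congrArg Subtype.val h
    have hcc : c = c' := by
      apply Subtype.ext
      rw [← hφc c t, ← hφc c' t']
      congr 3
    subst hcc
    have : t = t' := by
      apply pow_unit_eq (S c) (hS c) w hw
      intro i hi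
      have := congrFun h' i
      simp only [φ] at this
      have h3 := mul_right_cancel₀ (by simpa [S] using hi) this
      ext
      simpa using h3
    rw [this]
  have := Nat.card_le_card_of_injective Φ hinj
  rw [Nat.card_prod, Nat.card_coe_set_eq, Nat.card_eq_fintype_card (α := Fˣ), Fintype.card_units] at this
  exact this

lemma zeros_count {F : Type} [Field F] [Fintype F] {n : ℕ} (f : MvPolynomial (Fin n) F)
    (h0 : eval 0 f = 0) :
    (Nat.card {x : Fin n → F // x ≠ 0 ∧ eval x f = 0} : ℤ) + 1 + NZ f = (Fintype.card F : ℤ) ^ n := by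
  classical
  have h1 : (Nat.card {x : Fin n → F // x ≠ 0 ∧ eval x f = 0} : ℤ)
      = ∑ x : Fin n → F, if x ≠ 0 ∧ eval x f = 0 then 1 else 0 := by
    rw [Nat.card_eq_fintype_card, Fintype.card_subtype, Finset.sum_boole]
  have h2 : (1:ℤ) = ∑ x : Fin n → F, if x = 0 then 1 else 0 := by simp
  unfold NZ
  rw [h1]
  conv_lhs => rw [h2]
  rw [← Finset.sum_add_distrib, ← Finset.sum_add_distrib]
  have : ((Fintype.card F : ℤ)) ^ n = ∑ x : Fin n → F, 1 := by simp
  rw [this]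
  refine Finset.sum_congr rfl fun x _ => ?_
  by_cases hx : x = 0
  · subst hx; simp only [h0]; simp
  · by_cases hf : eval x f = 0 <;> simp [hx, hf]

lemma NZ_nonneg {F : Type} [Field F] [Fintype F] {n : ℕ} (f : MvPolynomial (Fin n) F) : 0 ≤ NZ f := by
  classical
  unfold NZ
  apply Finset.sum_nonneg
  intros
  split_ifs <;> simp

lemma NZ_rev {F : Type} [Field F] [Fintype F] {n : ℕ} (f : MvPolynomial (Fin n) F) :
    NZ (rename Fin.rev f) = NZ f := by
  classical
  unfold NZ
  refine Fintype.sum_bijective (fun x : Fin n → F => x ∘ Fin.rev) ?_ _ _ ?_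
  · apply Function.Involutive.bijective
    intro x
    funext i
    simp
  · intro x
    rw [eval_rename]

lemma hom_rev {F : Type} [Field F] {n : ℕ} {w : Fin n → ℕ} {d : ℕ} {f : MvPolynomial (Fin n) F}
    (hf : IsWeightedHomogeneous w f d) :
    IsWeightedHomogeneous (fun i => w i.rev) (rename Fin.rev f) d := by
  intro s hs
  obtain ⟨u, rfl, hu⟩ := coeff_rename_ne_zero _ _ _ hs
  rw [← hf hu, Finsupp.weight_apply, Finsupp.weight_apply, Finsupp.sum_mapDomain_index]
  · simp
  · simp
  · intros; simp [add_mul]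

lemma pSum_mul (q k : ℕ) : ((q:ℤ) - 1) * pSum q k = (q:ℤ) ^ k - 1 := by
  unfold pSum
  push_cast
  rw [mul_comm]
  exact geom_sum_mul _ _


/-- Proposition 4.5 of the paper: upper bound for `e_q` when
`gcd(w_0, w_i, q−1) = 1` for all `i ≥ 1`. -/
theorem stmt15 (F : Type) [Field F] [Fintype F] (m : ℕ) (hm : 2 ≤ m)
    (w : Fin (m + 1) → ℕ) (hpos : ∀ i, 1 ≤ w i)
    (hmono : ∀ i j : Fin (m + 1), 1 ≤ (i : ℕ) → i ≤ j → w i ≤ w j)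
    (hgcd : ∀ i : Fin (m + 1), 1 ≤ (i : ℕ) →
      Nat.gcd (Nat.gcd (w ⟨0, by omega⟩) (w i)) (Fintype.card F - 1) = 1)
    (d : ℕ) (hd : 1 ≤ d) :
    eMax F w d ≤
      min (pSum (Fintype.card F) (m + 1))
        (((d - 1) / w ⟨1, by omega⟩ + 1) * Fintype.card F ^ (m - 1)
          + pSum (Fintype.card F) (m - 1)) := by
  have hq1 : 1 < Fintype.card F := Fintype.one_lt_card
  unfold eMax
  apply csSup_le'
  rintro N ⟨f, hf0, hf, rfl⟩
  have hN := ncard_bound F w hpos f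
  have hz := zeros_count f (hom_pos_eval_zero hd hf)
  have hNZ0 := NZ_nonneg f
  set N := (vanishSet F w f).ncard with hNdef
  set B := (d - 1) / w ⟨1, by omega⟩ + 1 with hBdef
  set Z := Nat.card {x : Fin (m+1) → F // x ≠ 0 ∧ eval x f = 0} with hZ
  have hp := pSum_mul (Fintype.card F) (m+1)
  have hp2 := pSum_mul (Fintype.card F) (m-1)
  have hN' : ((Fintype.card F : ℤ) - 1) * N ≤ Z := by
    have : (((N * (Fintype.card F - 1) : ℕ)) : ℤ) ≤ Z := by exact_mod_cast hN
    rw [Nat.cast_mul, Nat.cast_sub hq1.le] at this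
    push_cast at this
    linarith
  have hcore : B ≤ Fintype.card F →
      (Fintype.card F : ℤ) ^ m * ((Fintype.card F - 1) * (Fintype.card F + 1 - B)) ≤
      Fintype.card F * NZ f := by
    intro hB
    have h1 := core m (fun i => w i.rev) (w ⟨1, by omega⟩) B d (rename Fin.rev f)
      (fun i => hpos _)
      (fun i hi => hmono _ _ le_rfl (by
        rw [Fin.le_def, Fin.val_rev]
        have : i.1 ≠ m := fun h => hi (Fin.ext h)
        have := i.2
        simp only
        omega))
      (fun i j hij hj => hmono _ _ (by
        rw [Fin.val_rev]
        have : j.1 ≠ m := fun h => hj (Fin.ext h)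
        have := j.2
        omega) (Fin.rev_le_rev.2 hij))
      hd (by
        have h2 := Nat.div_add_mod (d - 1) (w ⟨1, by omega⟩)
        have h3 := Nat.mod_lt (d - 1) (hpos ⟨1, by omega⟩)
        rw [hBdef, add_mul, mul_comm]
        omega)
      hB
      (fun h => hf0 (rename_injective _ Fin.rev_injective (by rw [h, map_zero])))
      (hom_rev hf)
    rwa [NZ_rev] at h1
  have hq1' : (1:ℤ) < (Fintype.card F : ℤ) := by exact_mod_cast hq1
  have e1 : (Fintype.card F : ℤ) ^ m = Fintype.card F ^ (m - 1) * Fintype.card F := by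
    rw [← pow_succ]; congr 1; omega
  have e2 : (Fintype.card F : ℤ) ^ (m + 1) = Fintype.card F ^ (m - 1) * Fintype.card F ^ 2 := by
    rw [← pow_add]; congr 1; omega
  generalize Fintype.card F = q at *
  apply le_min
  · have : ((q:ℤ) - 1) * N ≤ ((q:ℤ) - 1) * pSum q (m+1) := by linarith
    exact_mod_cast le_of_mul_le_mul_left this (by linarith)
  · have hr : 0 < (q:ℤ) ^ (m-1) := by positivity
    have key : ((q:ℤ) - 1) * N ≤ ((q:ℤ) - 1) * (B * (q:ℤ) ^ (m - 1) + pSum q (m - 1)) := by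
      rw [mul_add, hp2]
      rw [e2] at hz
      generalize (q:ℤ) ^ (m-1) = r at *
      by_cases hB : B ≤ q
      · have h := hcore hB
        rw [e1] at h
        have h' : r * (((q:ℤ) - 1) * (q + 1 - B)) ≤ NZ f := by
          refine le_of_mul_le_mul_left (a := (q:ℤ)) ?_ (by linarith)
          linarith
        nlinarith
      · have hB' : (q:ℤ) + 1 ≤ B := by exact_mod_cast not_le.1 hB
        have h3 : 0 ≤ r * (((q:ℤ) - 1) * (B - (q + 1))) :=
          mul_nonneg hr.le (mul_nonneg (by linarith) (by linarith))
        nlinarith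
    exact_mod_cast le_of_mul_le_mul_left key (by linarith)

end
end
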